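/- arXiv:1706.05444 — 6 statements merged into one kernel-verified Lean document; each statement's English description precedes it below -/
import Mathlib

section
/- For every nonnegative integer j, the sets A_4^j = {0, 2, 8, 9, 15, 20, 24, 26, 54, 56, 62, 63, 69, 74, 78, 80, 83, 89, 90, 96, 101, 105, 107, 135, 137, 143, 144, 150, 155, 159, 161, 162 + 243j} and B_4^j = {0, 4, 16, 18, 30, 40, 48, 52, 108, 112, 124, 126, 138, 148, 156, 160, 166, 178, 180, 192, 202, 210, 214, 270, 274, 286, 288, 300, 310, 318, 322, 324 + 243j} are near-modular with respect to 243. -/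
/-- The next term of a Stanley sequence: the least integer greater than all current
elements such that the extended set remains free of nontrivial 3-term APs. -/
noncomputable def stanleyNext (S : Finset ℕ) : ℕ :=
  sInf {x : ℕ | (∀ s ∈ S, s < x) ∧ ThreeAPFree (insert x (S : Set ℕ))}

/-- Iteratively extend the initial set `A` greedily. -/
noncomputable def stanleyIter (A : Finset ℕ) : ℕ → Finset ℕ
  | 0 => A
  | n + 1 => insert (stanleyNext (stanleyIter A n)) (stanleyIter A n)

/-- The set of terms of the Stanley sequence `S(A)`. -/
noncomputable def stanleySet (A : Finset ℕ) : Set ℕ :=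
  ⋃ n, (stanleyIter A n : Set ℕ)

/-- The Stanley sequence `S(A)` as a sequence, listed in increasing order. -/
noncomputable def stanleySeq (A : Finset ℕ) (n : ℕ) : ℕ :=
  Nat.nth (· ∈ stanleySet A) n

/-- A sequence is independent with character `lam` if there is `χ` such that for all
`k ≥ χ` and `0 ≤ i < 2^k`, `a (2^k + i) = a (2^k) + a i` and `a (2^k) = 2*a (2^k - 1) - lam + 1`. -/
def IsIndependent (a : ℕ → ℕ) (lam : ℕ) : Prop :=
  ∃ χ : ℕ, ∀ k ≥ χ, (∀ i < 2 ^ k, a (2 ^ k + i) = a (2 ^ k) + a i) ∧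
    a (2 ^ k) + lam = 2 * a (2 ^ k - 1) + 1

/-- `lam` is achieved as the character of an independent Stanley sequence. -/
def IsCharacter (lam : ℕ) : Prop :=
  ∃ A : Finset ℕ, 0 ∈ A ∧ ThreeAPFree (A : Set ℕ) ∧
    IsIndependent (stanleySeq A) lam

/-- A set `A` of nonnegative integers is near-modular with respect to `N`. -/
def NearModular (A : Set ℕ) (N : ℕ) : Prop :=
  0 ∈ A ∧
  (∀ x ∈ A, ∀ y ∈ A, ∀ z ∈ A,
    (x : ℤ) ≡ 2 * (y : ℤ) - (z : ℤ) [ZMOD (N : ℤ)] → x = y ∧ y = z) ∧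
  (∀ x : ℤ, ∃ y ∈ A, ∃ z ∈ A, z ≤ y ∧ x ≡ 2 * (y : ℤ) - (z : ℤ) [ZMOD (N : ℤ)])

/-- A modular set mod `N`: a near-modular set contained in `{0, …, N-1}`. -/
def IsModularSet (A : Finset ℕ) (N : ℕ) : Prop :=
  (∀ a ∈ A, a < N) ∧ NearModular (A : Set ℕ) N

/-- The Stanley sequence with term set `stanleySet A` is basic with basis `b`. -/
def IsBasicSequence (A : Finset ℕ) (b : ℕ → ℕ) : Prop :=
  (∃ α K : ℕ, ∀ k ≥ K, b k = α * 3 ^ k) ∧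
  stanleySet A = {x : ℕ | ∃ F : Finset ℕ, x = ∑ k ∈ F, b k}

/-- A finite criterion for near-modularity modulo an odd number. The binary digits of `D` mark the
doubled elements modulo `N`, and those of `M` mark the elements themselves. -/
theorem nearModular_of_testBit {L : List ℕ} {N : ℕ} (D M : ℕ) (hN : Nat.Coprime N 2) (h0 : 0 ∈ L)
    (hlt : ∀ x ∈ L, x < N) (hdouble : ∀ y ∈ L, D.testBit (2 * y % N))
    (hsum : ∀ x ∈ L, ∀ z ∈ L, D.testBit ((x + z) % N) → x = z)
    (hmem : ∀ z < N, M.testBit z → z ∈ L)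
    (hcover : ∀ r < N, ∃ y ∈ L, (2 * y + (N - r)) % N ≤ y ∧ M.testBit ((2 * y + (N - r)) % N)) :
    NearModular {x | x ∈ L} N := by
  have hpos : 0 < N := hlt 0 h0
  refine ⟨h0, fun x hx y hy z hz h ↦ ?_, fun x ↦ ?_⟩
  · have h' := h.add_right (z : ℤ)
    rw [sub_add_cancel] at h'
    have hxz : x + z ≡ 2 * y [MOD N] := Int.natCast_modEq_iff.mp (by push_cast; exact h')
    obtain rfl : x = z := hsum x hx z hz (by rw [hxz]; exact hdouble y hy)
    rw [← two_mul] at hxz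
    have hxy := (Nat.ModEq.cancel_left_of_coprime hN hxz).eq_of_lt_of_lt (hlt x hx) (hlt y hy)
    exact ⟨hxy, hxy.symm⟩
  · have hpos' : (0 : ℤ) < N := by exact_mod_cast hpos
    obtain ⟨r, hr⟩ := Int.eq_ofNat_of_zero_le (Int.emod_nonneg x hpos'.ne')
    have hrN : r < N := by
      have := Int.emod_lt_of_pos x hpos'
      rw [hr] at this
      exact_mod_cast this
    obtain ⟨y, hy, hzy, hz⟩ := hcover r hrN
    refine ⟨y, hy, _, hmem _ (Nat.mod_lt _ hpos) hz, hzy, ?_⟩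
    have hx : x ≡ r [ZMOD N] := hr ▸ (Int.mod_modEq x N).symm
    have hz' : (((2 * y + (N - r)) % N : ℕ) : ℤ) ≡ 2 * y + (N - r) [ZMOD N] := by
      push_cast [Nat.cast_sub hrN.le]
      exact Int.mod_modEq _ _
    refine hx.trans (((hz'.symm.sub_left (2 * (y : ℤ))).symm.trans ?_).symm)
    exact Int.modEq_iff_dvd.mpr ⟨1, by ring⟩

/-- Near-modularity is preserved by dilation by a factor coprime to the modulus. -/
theorem NearModular.image_mul {A : Set ℕ} {N c : ℕ} (hcN : Nat.Coprime c N)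
    (h : NearModular A N) : NearModular ((c * ·) '' A) N := by
  obtain ⟨h0, hfree, hcover⟩ := h
  refine ⟨⟨0, h0, by simp⟩, ?_, fun x ↦ ?_⟩
  · rintro _ ⟨x, hx, rfl⟩ _ ⟨y, hy, rfl⟩ _ ⟨z, hz, rfl⟩ h
    have h' : (c : ℤ) * x ≡ c * (2 * y - z) [ZMOD N] := by
      convert h using 1 <;> push_cast <;> ring
    rw [Int.modEq_iff_dvd, ← mul_sub] at h'
    have hxyz := hfree x hx y hy z hz (Int.modEq_iff_dvd.mpr
      (hcN.symm.isCoprime.dvd_of_dvd_mul_left h'))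
    exact ⟨congrArg (c * ·) hxyz.1, congrArg (c * ·) hxyz.2⟩
  · obtain ⟨d, hd⟩ := Int.mod_coprime hcN
    obtain ⟨y, hy, z, hz, hzy, h⟩ := hcover (d * x)
    refine ⟨c * y, ⟨y, hy, rfl⟩, c * z, ⟨z, hz, rfl⟩, Nat.mul_le_mul_left c hzy, ?_⟩
    have hx : x ≡ c * (d * x) [ZMOD N] := by
      simpa [mul_assoc] using (hd.mul_right x).symm
    refine hx.trans ?_
    convert h.mul_left (c : ℤ) using 1
    push_cast
    ring

/-- The largest element of a near-modular set may be increased by multiples of the modulus. -/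
theorem NearModular.insert_add_mul {A : Set ℕ} {N m : ℕ} (hA : ∀ a ∈ A, a < m) (h0 : 0 ∈ A)
    (h : NearModular (insert m A) N) (j : ℕ) : NearModular (insert (m + N * j) A) N := by
  obtain ⟨-, hfree, hcover⟩ := h
  have hmod : ((m + N * j : ℕ) : ℤ) ≡ m [ZMOD N] := by
    push_cast
    exact (Int.modEq_iff_dvd.mpr ⟨-j, by ring⟩)
  have hdown : ∀ x ∈ insert (m + N * j) A, ∃ x' ∈ insert m A, (x : ℤ) ≡ x' [ZMOD N] ∧
      x = if x' = m then m + N * j else x' := by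
    rintro x (rfl | hx)
    · exact ⟨m, .inl rfl, hmod, by simp⟩
    · exact ⟨x, .inr hx, .rfl, by simp [(hA x hx).ne]⟩
  refine ⟨.inr h0, fun x hx y hy z hz h ↦ ?_, fun x ↦ ?_⟩
  · obtain ⟨x', hx', hxx', rfl⟩ := hdown x hx
    obtain ⟨y', hy', hyy', rfl⟩ := hdown y hy
    obtain ⟨z', hz', hzz', rfl⟩ := hdown z hz
    obtain ⟨rfl, rfl⟩ := hfree x' hx' y' hy' z' hz'
      (hxx'.symm.trans (h.trans ((hyy'.mul_left 2).sub hzz')))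
    exact ⟨rfl, rfl⟩
  · obtain ⟨y, hy, z, hz, hzy, h⟩ := hcover x
    rcases hy with rfl | hy <;> rcases hz with rfl | hz
    · exact ⟨_, .inl rfl, _, .inl rfl, le_rfl,
        h.trans ((hmod.symm.mul_left 2).sub hmod.symm)⟩
    · exact ⟨_, .inl rfl, z, .inr hz, hzy.trans (Nat.le_add_right _ _),
        h.trans ((hmod.symm.mul_left 2).sub .rfl)⟩
    · exact absurd (hA y hy) hzy.not_gt
    · exact ⟨y, .inr hy, z, .inr hz, hzy, h⟩

/-- The elements of `A₄ʲ` other than the largest one. -/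
def initialA4 : List ℕ :=
  [0, 2, 8, 9, 15, 20, 24, 26, 54, 56, 62, 63, 69, 74, 78, 80, 83, 89,
    90, 96, 101, 105, 107, 135, 137, 143, 144, 150, 155, 159, 161]

theorem nearModular_insert_initialA4 : NearModular (insert 162 {x | x ∈ initialA4}) 243 := by
  have h : NearModular {x | x ∈ 162 :: initialA4} 243 :=
    nearModular_of_testBit
      27980011505654988579807208181116769343425011028612883434451566609
      9546893485408678475174697281388704453814985458437
      (by norm_num) (by decide) (by decide) (by decide +kernel) (by decide +kernel)
      (by decide +kernel) (by decide +kernel)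
  convert h using 1
  ext x
  simp

theorem lt_of_mem_initialA4 : ∀ a ∈ initialA4, a < 162 := by decide

/-- `A₄ʲ` and `B₄ʲ` are near-modular with respect to `243`. -/
theorem A4_B4_nearModular (j : ℕ) :
    NearModular ({0, 2, 8, 9, 15, 20, 24, 26, 54, 56, 62, 63, 69, 74, 78, 80, 83, 89,
      90, 96, 101, 105, 107, 135, 137, 143, 144, 150, 155, 159, 161,
      162 + 243 * j} : Set ℕ) 243 ∧
    NearModular ({0, 4, 16, 18, 30, 40, 48, 52, 108, 112, 124, 126, 138, 148, 156, 160,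
      166, 178, 180, 192, 202, 210, 214, 270, 274, 286, 288, 300, 310, 318, 322,
      324 + 243 * j} : Set ℕ) 243 := by
  constructor
  · have h := NearModular.insert_add_mul (A := {x | x ∈ initialA4}) lt_of_mem_initialA4
      (Set.mem_ofPred_eq ▸ by decide) nearModular_insert_initialA4 j
    rw [← Set.union_singleton] at h
    convert h using 1
    ext x
    simp only [initialA4, Set.mem_union, Set.mem_ofPred_eq, List.mem_cons, List.not_mem_nil,
      or_false, Set.mem_insert_iff, Set.mem_singleton_iff, or_assoc]
  · have h := nearModular_insert_initialA4.image_mul (c := 2) (by norm_num)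
    rw [Set.image_insert_eq] at h
    have hlt : ∀ a ∈ (2 * ·) '' {x | x ∈ initialA4}, a < 2 * 162 := by
      rintro _ ⟨a, ha, rfl⟩
      exact Nat.mul_lt_mul_of_pos_left (lt_of_mem_initialA4 a ha) two_pos
    have h' := h.insert_add_mul hlt ⟨0, Set.mem_ofPred_eq ▸ by decide, rfl⟩ j
    rw [← Set.union_singleton] at h'
    convert h' using 1
    ext x
    rw [Set.mem_union, Set.mem_image]
    simp only [Set.mem_ofPred_eq]
    rw [← List.mem_map]
    simp only [initialA4, List.map_cons, List.map_nil, List.mem_cons, List.not_mem_nil, or_false,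
      Set.mem_insert_iff, Set.mem_singleton_iff, or_assoc, Nat.reduceMul]
end

section
/- The set of terms of the Stanley sequence S({0}) is exactly the set of nonnegative integers whose ternary (base 3) expansion contains no digit 2. -/
/-- The ternary expansion of `x` contains no digit `2`. -/
def TernaryNoTwo (x : ℕ) : Prop := ∀ d ∈ Nat.digits 3 x, d ≠ 2

theorem ternaryNoTwo_zero : TernaryNoTwo 0 := by simp [TernaryNoTwo]

theorem ternaryNoTwo_iff (x : ℕ) : TernaryNoTwo x ↔ x % 3 ≠ 2 ∧ TernaryNoTwo (x / 3) := by
  rcases Nat.eq_zero_or_pos x with rfl | hx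
  · simp [TernaryNoTwo]
  · rw [TernaryNoTwo, Nat.digits_def' (by norm_num) hx, List.forall_mem_cons, TernaryNoTwo]

theorem TernaryNoTwo.three_mul_add {q r : ℕ} (hq : TernaryNoTwo q) (hr : r < 2) :
    TernaryNoTwo (3 * q + r) := by
  rw [ternaryNoTwo_iff]
  refine ⟨by omega, ?_⟩
  rwa [show (3 * q + r) / 3 = q by omega]

theorem TernaryNoTwo.eq_of_add_eq {a b c : ℕ} (ha : TernaryNoTwo a) (hb : TernaryNoTwo b)
    (hc : TernaryNoTwo c) (h : a + c = b + b) : a = b := by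
  induction b using Nat.strong_induction_on generalizing a c with
  | _ b ih =>
    rcases Nat.eq_zero_or_pos b with rfl | hpos
    · omega
    rw [ternaryNoTwo_iff] at ha hb hc
    have := ih (b / 3) (by omega) ha.2 hb.2 hc.2 (by omega)
    omega

theorem threeAPFree_setOf_ternaryNoTwo : ThreeAPFree {x | TernaryNoTwo x} :=
  fun _ ha _ hb _ hc h => ha.eq_of_add_eq hb hc h

/-- Every natural number is the third term of a possibly trivial progression `z ≤ y ≤ x` whose
first two terms avoid the ternary digit `2`. -/
theorem exists_ternaryNoTwo_add_eq (x : ℕ) :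
    ∃ y z, TernaryNoTwo y ∧ TernaryNoTwo z ∧ z ≤ y ∧ z + x = y + y := by
  induction x using Nat.strong_induction_on with
  | _ x ih =>
    rcases Nat.eq_zero_or_pos x with rfl | hpos
    · exact ⟨0, 0, ternaryNoTwo_zero, ternaryNoTwo_zero, le_rfl, rfl⟩
    obtain ⟨y, z, hy, hz, hzy, h⟩ := ih (x / 3) (by omega)
    have hr : x % 3 = 0 ∨ x % 3 = 1 ∨ x % 3 = 2 := by omega
    rcases hr with hr | hr | hr
    · exact ⟨3 * y + 0, 3 * z + 0, hy.three_mul_add (by omega), hz.three_mul_add (by omega),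
        by omega, by omega⟩
    · exact ⟨3 * y + 1, 3 * z + 1, hy.three_mul_add (by omega), hz.three_mul_add (by omega),
        by omega, by omega⟩
    · exact ⟨3 * y + 1, 3 * z + 0, hy.three_mul_add (by omega), hz.three_mul_add (by omega),
        by omega, by omega⟩

/-- If `S` consists of the numbers up to `m` avoiding the ternary digit `2`, then the greedy
extension of `S` is the next such number. -/
theorem stanleyNext_eq {S : Finset ℕ} {m m' : ℕ} (hS : ∀ x, x ∈ S ↔ TernaryNoTwo x ∧ x ≤ m)
    (hm : TernaryNoTwo m) (hm' : IsLeast {x | TernaryNoTwo x ∧ m < x} m') :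
    stanleyNext S = m' := by
  refine IsLeast.csInf_eq ⟨⟨fun s hs => ((hS s).1 hs).2.trans_lt hm'.1.2, ?_⟩, ?_⟩
  · refine threeAPFree_setOf_ternaryNoTwo.mono (Set.insert_subset hm'.1.1 fun s hs => ?_)
    exact ((hS s).1 hs).1
  · rintro x ⟨hgt, hfree⟩
    by_contra! hlt
    have hmx : m < x := hgt m ((hS m).2 ⟨hm, le_rfl⟩)
    have hx : ¬ TernaryNoTwo x := fun hx => hlt.not_ge (hm'.2 ⟨hx, hmx⟩)
    obtain ⟨y, z, hy, hz, hzy, h⟩ := exists_ternaryNoTwo_add_eq x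
    have hyx : y ≠ x := by
      rintro rfl
      exact hx hy
    have hym : y ≤ m := by
      by_contra! hmy
      have := hm'.2 ⟨hy, hmy⟩
      omega
    have hzS : z ∈ S := (hS z).2 ⟨hz, hzy.trans hym⟩
    have hyS : y ∈ S := (hS y).2 ⟨hy, hym⟩
    have hzy' : z = y := hfree (Set.mem_insert_of_mem _ hzS) (Set.mem_insert_of_mem _ hyS)
      (Set.mem_insert _ _) h
    omega

theorem exists_mem_stanleyIter_zero_iff (n : ℕ) :
    ∃ m, n ≤ m ∧ TernaryNoTwo m ∧ ∀ x, x ∈ stanleyIter {0} n ↔ TernaryNoTwo x ∧ x ≤ m := by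
  induction n with
  | zero =>
    refine ⟨0, le_rfl, ternaryNoTwo_zero, fun x => ?_⟩
    simp only [stanleyIter, Finset.mem_singleton, Nat.le_zero]
    exact ⟨fun h => ⟨h ▸ ternaryNoTwo_zero, h⟩, And.right⟩
  | succ n ih =>
    obtain ⟨m, hnm, hm, hS⟩ := ih
    have hne : {x | TernaryNoTwo x ∧ m < x}.Nonempty :=
      ⟨3 * m + 1, hm.three_mul_add (by omega), by omega⟩
    obtain ⟨m', hm'⟩ : ∃ m', IsLeast {x | TernaryNoTwo x ∧ m < x} m' :=
      ⟨_, Nat.sInf_mem hne, fun _ hx => Nat.sInf_le hx⟩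
    refine ⟨m', by have := hm'.1.2; omega, hm'.1.1, fun x => ?_⟩
    rw [stanleyIter, Finset.mem_insert, stanleyNext_eq hS hm hm', hS]
    constructor
    · rintro (rfl | ⟨hx, hxm⟩)
      · exact ⟨hm'.1.1, le_rfl⟩
      · exact ⟨hx, hxm.trans hm'.1.2.le⟩
    · rintro ⟨hx, hxm'⟩
      by_cases hxm : x ≤ m
      · exact Or.inr ⟨hx, hxm⟩
      · exact Or.inl (hxm'.antisymm (hm'.2 ⟨hx, not_le.1 hxm⟩))

/-- The set of terms of `S({0})` is the set of nonnegative integers whose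
ternary expansion contains no digit `2`. -/
theorem stanleySet_zero :
    stanleySet {0} = {x : ℕ | ∀ d ∈ Nat.digits 3 x, d ≠ 2} := by
  ext x
  simp only [stanleySet, Set.mem_iUnion, Finset.mem_coe]
  constructor
  · rintro ⟨n, hn⟩
    obtain ⟨m, -, -, hS⟩ := exists_mem_stanleyIter_zero_iff n
    exact ((hS x).1 hn).1
  · intro hx
    obtain ⟨m, hxm, -, hS⟩ := exists_mem_stanleyIter_zero_iff x
    exact ⟨x, (hS x).2 ⟨hx, hxm⟩⟩
end

section
/- Let k ≥ 0 and let B = (b_i)_{i≥0} be a sequence of positive integers such that 3^i is the largest power of 3 dividing b_i for every i, b_i = 3^i for all i ≥ k+1, and b_{k+1} > Σ_{i=0}^{k} b_i. Let (a_n) be the Stanley sequence whose set of terms is { Σ_{i≥0} δ_i·b_i : δ_i ∈ {0,1}, only finitely many δ_i nonzero }. Then a_{2^{k+2}−1} = Σ_{i=0}^{k+1} b_i, a_{2^{k+2}} = b_{k+2}, and (a_n) is independent with character λ = 2·Σ_{i=0}^{k} (b_i − 3^i). -/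
/-- Modulo `3 ^ (i + 1)`, a subset sum only sees the summands of index at most `i`. -/
theorem subsetSum_modEq {b : ℕ → ℕ} (hdvd : ∀ i, 3 ^ i ∣ b i) (F : Finset ℕ) (i : ℕ) :
    ∑ j ∈ F, b j ≡ ∑ j ∈ F with j < i, b j + (if i ∈ F then b i else 0) [MOD 3 ^ (i + 1)] := by
  have hsplit : ∑ j ∈ F with ¬ j < i, b j =
      (if i ∈ F then b i else 0) + ∑ j ∈ F with i < j, b j := by
    rw [← Finset.sum_ite_eq' F i b, Finset.sum_filter, Finset.sum_filter,
      ← Finset.sum_add_distrib]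
    refine Finset.sum_congr rfl fun j _ => ?_
    rcases lt_trichotomy j i with h | h | h
    · simp [h, h.ne, h.le]
    · simp [h]
    · simp [h, h.ne', h.le]
  have hzero : 3 ^ (i + 1) ∣ ∑ j ∈ F with i < j, b j :=
    Finset.dvd_sum fun j hj =>
      (pow_dvd_pow 3 (Finset.mem_filter.mp hj).2).trans (hdvd j)
  rw [← Finset.sum_filter_add_sum_filter_not F (· < i), hsplit, ← add_assoc]
  exact Nat.ModEq.add_left _ ((Nat.modEq_zero_iff_dvd).mpr hzero)

/-- If `3 ^ i` exactly divides `b i` for every `i`, then distinct subsets have distinct sums. -/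
theorem subsetSum_injective {b : ℕ → ℕ}
    (hdvd : ∀ i, 3 ^ i ∣ b i ∧ ¬ 3 ^ (i + 1) ∣ b i) :
    Function.Injective fun F : Finset ℕ => ∑ i ∈ F, b i := by
  intro F G hFG
  ext i
  induction i using Nat.strong_induction_on with
  | _ i ih =>
    have hfilter : F.filter (· < i) = G.filter (· < i) := by
      ext j
      simp only [Finset.mem_filter]
      exact and_congr_left (ih j)
    have hF := subsetSum_modEq (fun i => (hdvd i).1) F i
    have hG := subsetSum_modEq (fun i => (hdvd i).1) G i
    have hmod : (if i ∈ F then b i else 0) ≡ (if i ∈ G then b i else 0) [MOD 3 ^ (i + 1)] := by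
      rw [hfilter] at hF
      exact Nat.ModEq.add_left_cancel' _ (hF.symm.trans ((congrArg (· % _) hFG).trans hG))
    have hb := (hdvd i).2
    by_cases h₁ : i ∈ F <;> by_cases h₂ : i ∈ G <;> simp only [h₁, h₂, if_true, if_false] at hmod ⊢
    · exact absurd ((Nat.modEq_zero_iff_dvd).mp hmod) hb
    · exact absurd ((Nat.modEq_zero_iff_dvd).mp hmod.symm) hb

/-- A subset sum lying below every `b i` with `i ≥ m` only uses indices below `m`. -/
theorem subset_range_of_subsetSum_lt {b : ℕ → ℕ} {m : ℕ} {F : Finset ℕ}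
    (hmono : ∀ i ≥ m, b m ≤ b i) (hF : ∑ i ∈ F, b i < b m) : F ⊆ Finset.range m := by
  intro i hi
  by_contra h
  have hle : b i ≤ ∑ j ∈ F, b j := Finset.single_le_sum (fun _ _ => Nat.zero_le _) hi
  have := hmono i (by simpa using h)
  omega

section SubsetSums

variable {b : ℕ → ℕ} {m : ℕ} {T : Set ℕ}

open Classical in
/-- There are exactly `2 ^ m` subset sums below `n`, if `n` separates the sum of the first `m`
elements from `b m`. -/
theorem count_subsetSums (hT : T = {x | ∃ F : Finset ℕ, x = ∑ i ∈ F, b i})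
    (hinj : Function.Injective fun F : Finset ℕ => ∑ i ∈ F, b i)
    (hmono : ∀ i ≥ m, b m ≤ b i) {n : ℕ} (hn : ∑ i ∈ Finset.range m, b i < n)
    (hnb : n ≤ b m) : Nat.count (· ∈ T) n = 2 ^ m := by
  have himage : (Finset.range n).filter (· ∈ T) =
      (Finset.range m).powerset.image fun F => ∑ i ∈ F, b i := by
    ext x
    simp only [hT, Finset.mem_filter, Finset.mem_range, Finset.mem_image, Finset.mem_powerset,
      Set.mem_ofPred_eq]
    constructor
    · rintro ⟨hx, F, rfl⟩
      exact ⟨F, subset_range_of_subsetSum_lt hmono (hx.trans_le hnb), rfl⟩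
    · rintro ⟨F, hF, rfl⟩
      exact ⟨(Finset.sum_le_sum_of_subset hF).trans_lt hn, F, rfl⟩
  rw [Nat.count_eq_card_filter_range, himage, Finset.card_image_of_injective _ hinj,
    Finset.card_powerset, Finset.card_range]

/-- The subset sums just above `b m` are the translates by `b m` of those below it. -/
theorem add_mem_subsetSums_iff (hT : T = {x | ∃ F : Finset ℕ, x = ∑ i ∈ F, b i})
    (hmono : ∀ i ≥ m, b m ≤ b i) (hmono' : ∀ i ≥ m + 1, b (m + 1) ≤ b i)
    (hsum : ∑ i ∈ Finset.range m, b i < b m) (hdouble : 2 * b m ≤ b (m + 1))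
    {y : ℕ} (hy : y < b m) : b m + y ∈ T ↔ y ∈ T := by
  simp only [hT, Set.mem_ofPred_eq]
  constructor
  · rintro ⟨F, hF⟩
    have hsub : F ⊆ Finset.range (m + 1) := subset_range_of_subsetSum_lt hmono' (by omega)
    have hm : m ∈ F := by
      by_contra hm
      have hsub' : F ⊆ Finset.range m := by
        intro i hi
        have := Finset.mem_range.mp (hsub hi)
        have : i ≠ m := fun h => hm (h ▸ hi)
        exact Finset.mem_range.mpr (by omega)
      have : ∑ i ∈ F, b i ≤ ∑ i ∈ Finset.range m, b i := Finset.sum_le_sum_of_subset hsub'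
      omega
    exact ⟨F.erase m, by have := Finset.add_sum_erase F b hm; omega⟩
  · rintro ⟨F, rfl⟩
    have hm : m ∉ F := fun h => by
      simpa using subset_range_of_subsetSum_lt hmono hy h
    exact ⟨insert m F, (Finset.sum_insert hm).symm⟩

theorem nth_subsetSums_two_pow (hT : T = {x | ∃ F : Finset ℕ, x = ∑ i ∈ F, b i})
    (hinj : Function.Injective fun F : Finset ℕ => ∑ i ∈ F, b i)
    (hmono : ∀ i ≥ m, b m ≤ b i) (hsum : ∑ i ∈ Finset.range m, b i < b m) :
    Nat.nth (· ∈ T) (2 ^ m) = b m := by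
  classical
  rw [← count_subsetSums hT hinj hmono hsum le_rfl]
  exact Nat.nth_count (p := (· ∈ T)) (by rw [hT]; exact ⟨{m}, by simp⟩)

theorem nth_subsetSums_two_pow_sub_one (hT : T = {x | ∃ F : Finset ℕ, x = ∑ i ∈ F, b i})
    (hinj : Function.Injective fun F : Finset ℕ => ∑ i ∈ F, b i)
    (hmono : ∀ i ≥ m, b m ≤ b i) (hsum : ∑ i ∈ Finset.range m, b i < b m) :
    Nat.nth (· ∈ T) (2 ^ m - 1) = ∑ i ∈ Finset.range m, b i := by
  classical
  have hmem : ∑ i ∈ Finset.range m, b i ∈ T := by rw [hT]; exact ⟨_, rfl⟩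
  have hcount := count_subsetSums hT hinj hmono (Nat.lt_succ_self _) hsum
  rw [Nat.succ_eq_add_one, Nat.count_succ, if_pos hmem] at hcount
  rw [← hcount, Nat.add_sub_cancel]
  exact Nat.nth_count (p := (· ∈ T)) hmem

theorem nth_subsetSums_two_pow_add (hT : T = {x | ∃ F : Finset ℕ, x = ∑ i ∈ F, b i})
    (hinj : Function.Injective fun F : Finset ℕ => ∑ i ∈ F, b i) (hinf : T.Infinite)
    (hmono : ∀ i ≥ m, b m ≤ b i) (hmono' : ∀ i ≥ m + 1, b (m + 1) ≤ b i)
    (hsum : ∑ i ∈ Finset.range m, b i < b m) (hdouble : 2 * b m ≤ b (m + 1))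
    {i : ℕ} (hi : i < 2 ^ m) :
    Nat.nth (· ∈ T) (2 ^ m + i) = b m + Nat.nth (· ∈ T) i := by
  classical
  have hcount := count_subsetSums hT hinj hmono hsum le_rfl
  have hlt : Nat.nth (· ∈ T) i < b m := Nat.nth_lt_of_lt_count (hcount ▸ hi)
  have hmem : Nat.nth (· ∈ T) i ∈ T := Nat.nth_mem_of_infinite (p := (· ∈ T)) hinf i
  have hshift : Nat.count (fun y => b m + y ∈ T) (Nat.nth (· ∈ T) i) = i := by
    conv_rhs => rw [← Nat.count_nth_of_infinite (p := (· ∈ T)) hinf i]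
    rw [Nat.count_eq_card_filter_range, Nat.count_eq_card_filter_range]
    congr 1
    refine Finset.filter_congr fun y hy => ?_
    exact add_mem_subsetSums_iff hT hmono hmono' hsum hdouble
      ((Finset.mem_range.mp hy).trans hlt)
  have htotal : Nat.count (· ∈ T) (b m + Nat.nth (· ∈ T) i) = 2 ^ m + i := by
    rw [Nat.count_add, hcount, hshift]
  rw [← htotal]
  exact Nat.nth_count (p := (· ∈ T))
    ((add_mem_subsetSums_iff hT hmono hmono' hsum hdouble hlt).mpr hmem)

end SubsetSums

theorem sum_range_lt_of_eventually_three_pow {k : ℕ} {b : ℕ → ℕ}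
    (hev : ∀ i ≥ k + 1, b i = 3 ^ i)
    (hbig : ∑ i ∈ Finset.range (k + 1), b i < b (k + 1)) :
    ∀ m ≥ k + 1, ∑ i ∈ Finset.range m, b i < b m := by
  intro m hm
  induction m, hm using Nat.le_induction with
  | base => exact hbig
  | succ m hm ih =>
    rw [Finset.sum_range_succ, hev (m + 1) (by omega), pow_succ, ← hev m hm]
    omega

theorem two_mul_sum_range_add_one {k m : ℕ} {b : ℕ → ℕ} (hle : ∀ i, 3 ^ i ≤ b i)
    (hev : ∀ i ≥ k + 1, b i = 3 ^ i) (hm : k + 1 ≤ m) :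
    2 * ∑ i ∈ Finset.range m, b i + 1 =
      3 ^ m + 2 * ∑ i ∈ Finset.range (k + 1), (b i - 3 ^ i) := by
  induction m, hm using Nat.le_induction with
  | base =>
    have hgeom : 2 * ∑ i ∈ Finset.range (k + 1), 3 ^ i + 1 = 3 ^ (k + 1) := by
      rw [mul_comm]
      exact geom_sum_mul_add 2 (k + 1)
    have hsplit : ∑ i ∈ Finset.range (k + 1), b i =
        ∑ i ∈ Finset.range (k + 1), (b i - 3 ^ i) + ∑ i ∈ Finset.range (k + 1), 3 ^ i := by
      rw [← Finset.sum_add_distrib]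
      exact Finset.sum_congr rfl fun i _ => (Nat.sub_add_cancel (hle i)).symm
    omega
  | succ m hm ih =>
    rw [Finset.sum_range_succ, hev m hm, pow_succ]
    omega


/-- For a basis `(b i)` with `3^i` the exact power of `3` dividing `b i`,
`b i = 3^i` for `i ≥ k+1`, and `b (k+1) > Σ_{i ≤ k} b i`, the Stanley sequence with term
set `{Σ_{i ∈ F} b i}` satisfies `a_{2^(k+2)-1} = Σ_{i ≤ k+1} b i`, `a_{2^(k+2)} = b (k+2)`,
and is independent with character `2 Σ_{i ≤ k} (b i - 3^i)`. -/
theorem basic_sequence_character (k : ℕ) (b : ℕ → ℕ) (hpos : ∀ i, 0 < b i)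
    (hdvd : ∀ i, 3 ^ i ∣ b i ∧ ¬ 3 ^ (i + 1) ∣ b i)
    (hev : ∀ i ≥ k + 1, b i = 3 ^ i)
    (hbig : ∑ i ∈ Finset.range (k + 1), b i < b (k + 1))
    (A : Finset ℕ) (h0 : 0 ∈ A) (hAP : ThreeAPFree (A : Set ℕ))
    (hterms : stanleySet A = {x : ℕ | ∃ F : Finset ℕ, x = ∑ i ∈ F, b i}) :
    stanleySeq A (2 ^ (k + 2) - 1) = ∑ i ∈ Finset.range (k + 2), b i ∧
    stanleySeq A (2 ^ (k + 2)) = b (k + 2) ∧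
    IsIndependent (stanleySeq A) (2 * ∑ i ∈ Finset.range (k + 1), (b i - 3 ^ i)) := by
  have hinj := subsetSum_injective hdvd
  have hle : ∀ i, 3 ^ i ≤ b i := fun i => Nat.le_of_dvd (hpos i) (hdvd i).1
  have hsum := sum_range_lt_of_eventually_three_pow hev hbig
  have hmono : ∀ m ≥ k + 1, ∀ i ≥ m, b m ≤ b i := fun m hm i hi => by
    rw [hev m hm, hev i (hm.le.trans hi)]
    exact Nat.pow_le_pow_right (by norm_num) hi
  have hinf : (stanleySet A).Infinite := by
    refine Set.infinite_of_forall_exists_gt fun n => ⟨b n, ?_, ?_⟩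
    · rw [hterms]
      exact ⟨{n}, by simp⟩
    · exact (Nat.lt_pow_self (by norm_num)).trans_le (hle n)
  have htwo : ∀ m ≥ k + 1, stanleySeq A (2 ^ m) = b m := fun m hm =>
    nth_subsetSums_two_pow hterms hinj (hmono m hm) (hsum m hm)
  have hpred : ∀ m ≥ k + 1, stanleySeq A (2 ^ m - 1) = ∑ i ∈ Finset.range m, b i :=
    fun m hm => nth_subsetSums_two_pow_sub_one hterms hinj (hmono m hm) (hsum m hm)
  refine ⟨hpred _ (by omega), htwo _ (by omega), k + 1, fun m hm => ⟨fun i hi => ?_, ?_⟩⟩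
  · have hdouble : 2 * b m ≤ b (m + 1) := by
      rw [hev m hm, hev (m + 1) (by omega), pow_succ]
      omega
    rw [htwo m hm]
    exact nth_subsetSums_two_pow_add hterms hinj hinf (hmono m hm)
      (hmono (m + 1) (by omega)) (hsum m hm) hdouble hi
  · rw [htwo m hm, hpred m hm, two_mul_sum_range_add_one hle hev hm, hev m hm]
end

section
/- For each i ∈ {1, 2, 3, 4} and each nonnegative integer ℓ, both 3^i + 1 + 2ℓ·3^{i+1} and 5·3^i + 1 + 2ℓ·3^{i+1} can be achieved as characters of independent Stanley sequences. -/
/-- The natural numbers whose ternary expansion only uses the digits `0` and `1`. -/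
inductive TernaryBinary : ℕ → Prop
  | zero : TernaryBinary 0
  | append_zero {n : ℕ} : TernaryBinary n → TernaryBinary (3 * n)
  | append_one {n : ℕ} : TernaryBinary n → TernaryBinary (3 * n + 1)

namespace TernaryBinary

theorem cases_mod {n : ℕ} (h : TernaryBinary n) :
    ∃ m, TernaryBinary m ∧ (n = 3 * m ∨ n = 3 * m + 1) := by
  cases h with
  | zero => exact ⟨0, zero, Or.inl rfl⟩
  | append_zero h => exact ⟨_, h, Or.inl rfl⟩
  | append_one h => exact ⟨_, h, Or.inr rfl⟩

theorem exists_add_eq_two_mul (q : ℕ) :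
    ∃ d e, TernaryBinary d ∧ TernaryBinary e ∧ e ≤ d ∧ q + e = 2 * d := by
  induction q using Nat.strong_induction_on with
  | _ q ih =>
    rcases Nat.eq_zero_or_pos q with rfl | hq
    · exact ⟨0, 0, zero, zero, le_rfl, rfl⟩
    obtain ⟨d, e, hd, he, hle, heq⟩ := ih (q / 3) (by omega)
    have hr : q % 3 = 0 ∨ q % 3 = 1 ∨ q % 3 = 2 := by omega
    rcases hr with hr | hr | hr
    · exact ⟨_, _, hd.append_zero, he.append_zero, by omega, by omega⟩
    · exact ⟨_, _, hd.append_one, he.append_one, by omega, by omega⟩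
    · exact ⟨_, _, hd.append_one, he.append_zero, by omega, by omega⟩

theorem eq_of_add_eq_two_mul (x : ℕ) : ∀ y z, TernaryBinary x → TernaryBinary y →
    TernaryBinary z → x + z = 2 * y → x = y := by
  induction x using Nat.strong_induction_on with
  | _ x ih =>
    intro y z hx hy hz h
    obtain ⟨x', hx', hxx⟩ := hx.cases_mod
    obtain ⟨y', hy', hyy⟩ := hy.cases_mod
    obtain ⟨z', hz', hzz⟩ := hz.cases_mod
    rcases Nat.eq_zero_or_pos x with rfl | hpos
    · by_contra hne
      have key : ∀ y z, TernaryBinary y → TernaryBinary z → z = 2 * y → y = 0 := by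
        intro y
        induction y using Nat.strong_induction_on with
        | _ y ihy =>
          intro z hy hz h
          obtain ⟨y', hy', hyy⟩ := hy.cases_mod
          obtain ⟨z', hz', hzz⟩ := hz.cases_mod
          by_contra hy0
          have := ihy y' (by omega) z' hy' hz' (by omega)
          omega
      have := key y z hy hz (by omega)
      omega
    · have := ih x' (by omega) y' z' hx' hy' hz' (by omega)
      omega

theorem pow_add_iff (n : ℕ) : ∀ d < 3 ^ n, (TernaryBinary (3 ^ n + d) ↔ TernaryBinary d) := by
  induction n with
  | zero =>
    intro d hd
    obtain rfl : d = 0 := by simpa using hd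
    exact ⟨fun _ => zero, fun _ => zero.append_one⟩
  | succ n ih =>
    intro d hd
    rw [pow_succ] at hd ⊢
    have key := ih (d / 3) (by omega)
    constructor
    · intro h
      obtain ⟨m, hm, hmm⟩ := h.cases_mod
      obtain rfl : m = 3 ^ n + d / 3 := by omega
      have hd' := key.1 hm
      rcases hmm with hmm | hmm
      · rw [show d = 3 * (d / 3) by omega]
        exact hd'.append_zero
      · rw [show d = 3 * (d / 3) + 1 by omega]
        exact hd'.append_one
    · intro h
      obtain ⟨m, hm, rfl | rfl⟩ := h.cases_mod
      · rw [show 3 * m / 3 = m by omega] at key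
        rw [show 3 ^ n * 3 + 3 * m = 3 * (3 ^ n + m) by ring]
        exact (key.2 hm).append_zero
      · rw [show (3 * m + 1) / 3 = m by omega] at key
        rw [show 3 ^ n * 3 + (3 * m + 1) = 3 * (3 ^ n + m) + 1 by ring]
        exact (key.2 hm).append_one

theorem two_mul_lt {n : ℕ} : ∀ {d : ℕ}, TernaryBinary d → d < 3 ^ n → 2 * d < 3 ^ n := by
  induction n with
  | zero => intro d _ hd; simp at hd ⊢; omega
  | succ n ih =>
    intro d h hd
    rw [pow_succ] at hd ⊢
    obtain ⟨m, hm, hmm⟩ := h.cases_mod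
    have := ih hm (by omega)
    omega

end TernaryBinary

theorem stanleySet_eq_of_covered {T : Set ℕ} (hT : ThreeAPFree T) (hinf : T.Infinite)
    {A : Finset ℕ} {c : ℕ} (hA : ∀ x, x ∈ A ↔ x ∈ T ∧ x ≤ c) (hc : c ∈ T)
    (hcov : ∀ x, c < x → x ∉ T → ∃ y ∈ T, ∃ z ∈ T, z < y ∧ x + z = 2 * y) :
    stanleySet A = T := by
  classical
  have hnext : ∀ (S : Finset ℕ) (b : ℕ), c ≤ b → (∀ x, x ∈ S ↔ x ∈ T ∧ x ≤ b) →
      b < stanleyNext S ∧ ∀ x, x ∈ insert (stanleyNext S) S ↔ x ∈ T ∧ x ≤ stanleyNext S := by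
    intro S b hcb hS
    have hex : ∃ t, t ∈ T ∧ b < t := hinf.exists_gt b
    obtain ⟨ht, hbt⟩ := Nat.find_spec hex
    have hmin : ∀ x, x ∈ T → b < x → Nat.find hex ≤ x :=
      fun x hx hbx => Nat.find_min' hex ⟨hx, hbx⟩
    generalize Nat.find hex = t at ht hbt hmin
    have hmem : t ∈ {x : ℕ | (∀ s ∈ S, s < x) ∧ ThreeAPFree (insert x (S : Set ℕ))} := by
      refine ⟨fun s hs => lt_of_le_of_lt ((hS s).1 hs).2 hbt, hT.mono ?_⟩
      intro x hx
      rcases hx with rfl | hx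
      · exact ht
      · exact ((hS x).1 hx).1
    have heq : stanleyNext S = t := by
      refine le_antisymm (Nat.sInf_le hmem) (le_csInf ⟨t, hmem⟩ ?_)
      rintro x ⟨hxS, hfree⟩
      by_contra! hlt
      have hcx : c < x := hxS c ((hS c).2 ⟨hc, hcb⟩)
      have hsmall : ∀ y, y ∈ T → y < t → y ∈ S := fun y hy hyt =>
        (hS y).2 ⟨hy, by by_contra! hb; exact absurd (hmin y hy hb) (by omega)⟩
      have hxT : x ∉ T := fun hx => lt_irrefl x (hxS x (hsmall x hx hlt))
      obtain ⟨y, hy, z, hz, hzy, h⟩ := hcov x hcx hxT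
      have hxy := hfree (Set.mem_insert x _)
        (Set.mem_insert_of_mem x (hsmall y hy (by omega)))
        (Set.mem_insert_of_mem x (hsmall z hz (by omega))) (by omega)
      omega
    rw [heq]
    refine ⟨hbt, fun x => ?_⟩
    rw [Finset.mem_insert, hS]
    constructor
    · rintro (rfl | ⟨hx, hxb⟩)
      · exact ⟨ht, le_rfl⟩
      · exact ⟨hx, by omega⟩
    · rintro ⟨hx, hxt⟩
      by_cases hb : x ≤ b
      · exact Or.inr ⟨hx, hb⟩
      · exact Or.inl (le_antisymm hxt (hmin x hx (by omega)))
  have hiter : ∀ n, ∃ b, c + n ≤ b ∧ ∀ x, x ∈ stanleyIter A n ↔ x ∈ T ∧ x ≤ b := by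
    intro n
    induction n with
    | zero => exact ⟨c, le_rfl, hA⟩
    | succ n ih =>
      obtain ⟨b, hb, hS⟩ := ih
      obtain ⟨h1, h2⟩ := hnext _ b (by omega) hS
      exact ⟨_, by omega, h2⟩
  ext x
  simp only [stanleySet, Set.mem_iUnion, Finset.mem_coe]
  constructor
  · rintro ⟨n, hn⟩
    obtain ⟨b, -, hS⟩ := hiter n
    exact ((hS x).1 hn).1
  · intro hx
    obtain ⟨b, hb, hS⟩ := hiter x
    exact ⟨x, (hS x).2 ⟨hx, by omega⟩⟩

/-- The natural number whose binary digit at position `r` is `1` if and only if `r ∈ L`. -/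
def bitMask (L : List ℕ) : ℕ :=
  L.foldr (fun r m => (1 <<< r) ||| m) 0

theorem testBit_bitMask {L : List ℕ} {r : ℕ} : (bitMask L).testBit r = true ↔ r ∈ L := by
  induction L with
  | nil => simp [bitMask]
  | cons a L ih =>
    rw [bitMask, List.foldr_cons, ← bitMask, Nat.testBit_lor, Bool.or_eq_true, ih,
      Nat.one_shiftLeft, Nat.testBit_two_pow, decide_eq_true_iff, List.mem_cons, eq_comm]

/-- The residues of `2 * y - z` modulo `N` for `y`, `z` in `L` satisfying `p y z`. -/
def thirdTerms (p : ℕ → ℕ → Bool) (L : List ℕ) (N : ℕ) : List ℕ :=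
  L.flatMap fun y => (L.filter (p y)).map fun z => (2 * y + (N - 1) * z) % N

theorem mem_thirdTerms {p : ℕ → ℕ → Bool} {L : List ℕ} {N r : ℕ} :
    r ∈ thirdTerms p L N ↔
      ∃ y ∈ L, ∃ z ∈ L, p y z = true ∧ r = (2 * y + (N - 1) * z) % N := by
  simp only [thirdTerms, List.mem_flatMap, List.mem_map, List.mem_filter, and_assoc,
    eq_comm (a := r)]

/-- `A` is a near-modular set with respect to `N`, with `2 ^ s` elements and maximum `M`. -/
structure NearModularWithMax (A : Finset ℕ) (N M s : ℕ) : Prop where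
  pos : 0 < N
  zero_mem : 0 ∈ A
  max_mem : M ∈ A
  le_max : ∀ a ∈ A, a ≤ M
  card_eq : A.card = 2 ^ s
  free : ∀ x ∈ A, ∀ y ∈ A, ∀ z ∈ A, x + z ≡ 2 * y [MOD N] → x = y ∧ y = z
  cover : ∀ x, ∃ y ∈ A, ∃ z ∈ A, z ≤ y ∧ x + z ≡ 2 * y [MOD N]

namespace NearModularWithMax

variable {A : Finset ℕ} {N M s : ℕ}

theorem eq_of_modEq (h : NearModularWithMax A N M s) {a b : ℕ} (ha : a ∈ A) (hb : b ∈ A)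
    (hab : a ≡ b [MOD N]) : a = b :=
  (h.free a ha b hb b hb (by rw [two_mul]; exact hab.add_right b)).1

theorem shift_max (h : NearModularWithMax A N M s) (hM : 0 < M) (l : ℕ) :
    NearModularWithMax (A.image fun a => if a = M then M + N * l else a) N (M + N * l) s := by
  set f : ℕ → ℕ := fun a => if a = M then M + N * l else a with hf
  have hmod : ∀ a, f a ≡ a [MOD N] := by
    intro a
    by_cases ha : a = M
    · simp [hf, ha, Nat.ModEq]
    · simp [hf, ha, Nat.ModEq]
  have hmono : ∀ a ∈ A, ∀ b ∈ A, a ≤ b → f a ≤ f b := by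
    intro a _ b hb hab
    have := h.le_max b hb
    by_cases haM : a = M
    · have : b = M := by omega
      simp [hf, haM, this]
    · by_cases hbM : b = M
      · simp only [hf, haM, hbM, if_true, if_false]
        omega
      · simpa [hf, haM, hbM] using hab
  have hfM : f M = M + N * l := by simp [hf]
  refine ⟨h.pos, ?_, ?_, ?_, ?_, ?_, ?_⟩
  · exact Finset.mem_image.2 ⟨0, h.zero_mem, by simp [hf, hM.ne]⟩
  · exact Finset.mem_image.2 ⟨M, h.max_mem, hfM⟩
  · intro a ha
    obtain ⟨b, hb, rfl⟩ := Finset.mem_image.1 ha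
    rw [← hfM]
    exact hmono b hb M h.max_mem (h.le_max b hb)
  · rw [Finset.card_image_of_injOn, h.card_eq]
    intro a ha b hb hab
    exact h.eq_of_modEq ha hb ((hmod a).symm.trans ((congrArg (· % N) hab).trans (hmod b)))
  · intro x hx y hy z hz hxyz
    obtain ⟨a, ha, rfl⟩ := Finset.mem_image.1 hx
    obtain ⟨b, hb, rfl⟩ := Finset.mem_image.1 hy
    obtain ⟨c, hc, rfl⟩ := Finset.mem_image.1 hz
    obtain ⟨rfl, rfl⟩ := h.free a ha b hb c hc
      ((((hmod a).add (hmod c)).symm.trans hxyz).trans ((hmod b).mul_left 2))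
    exact ⟨rfl, rfl⟩
  · intro x
    obtain ⟨y, hy, z, hz, hzy, hx⟩ := h.cover x
    exact ⟨f y, Finset.mem_image_of_mem f hy, f z, Finset.mem_image_of_mem f hz,
      hmono z hz y hy hzy,
      (((hmod z).add_left x).trans hx).trans ((hmod y).mul_left 2).symm⟩

theorem triple (h : NearModularWithMax A N M s) :
    NearModularWithMax (A ∪ A.image (N + ·)) (3 * N) (N + M) (s + 1) := by
  have hN := h.pos
  have hmem : ∀ x, x ∈ A ∪ A.image (N + ·) ↔ ∃ a ∈ A, ∃ e, e < 2 ∧ x = a + N * e := by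
    intro x
    simp only [Finset.mem_union, Finset.mem_image]
    constructor
    · rintro (hx | ⟨a, ha, rfl⟩)
      · exact ⟨x, hx, 0, by norm_num, by simp⟩
      · exact ⟨a, ha, 1, by norm_num, by ring⟩
    · rintro ⟨a, ha, e, he, rfl⟩
      interval_cases e
      · exact Or.inl (by simpa using ha)
      · exact Or.inr ⟨a, ha, by ring⟩
  have hred : ∀ a e, a + N * e ≡ a [MOD N] := fun a e => by simp [Nat.ModEq]
  refine ⟨by omega, ?_, ?_, ?_, ?_, ?_, ?_⟩
  · exact Finset.mem_union_left _ h.zero_mem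
  · exact Finset.mem_union_right _ (Finset.mem_image_of_mem _ h.max_mem)
  · intro x hx
    rcases Finset.mem_union.1 hx with hx | hx
    · have := h.le_max x hx
      omega
    · obtain ⟨a, ha, rfl⟩ := Finset.mem_image.1 hx
      have := h.le_max a ha
      omega
  · rw [Finset.card_union_of_disjoint, Finset.card_image_of_injective _ (add_right_injective N),
      h.card_eq, pow_succ]
    · ring
    · rw [Finset.disjoint_left]
      intro x hx hx'
      obtain ⟨a, ha, rfl⟩ := Finset.mem_image.1 hx'
      have := h.eq_of_modEq hx ha (by simp [Nat.ModEq])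
      omega
  · intro x hx y hy z hz hxyz
    obtain ⟨a, ha, e, he, rfl⟩ := (hmem x).1 hx
    obtain ⟨b, hb, f, hf, rfl⟩ := (hmem y).1 hy
    obtain ⟨c, hc, g, hg, rfl⟩ := (hmem z).1 hz
    obtain ⟨rfl, rfl⟩ := h.free a ha b hb c hc
      ((((hred a e).add (hred c g)).symm.trans (hxyz.of_mul_left 3)).trans
        ((hred b f).mul_left 2))
    have h1 : 2 * a + N * (e + g) ≡ 2 * a + N * (2 * f) [MOD 3 * N] := by
      convert hxyz using 1 <;> ring
    have h2 : N * (e + g) ≡ N * (2 * f) [MOD N * 3] := by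
      rw [mul_comm N 3]; exact Nat.ModEq.add_left_cancel' _ h1
    have h3 : (e + g) % 3 = (2 * f) % 3 := Nat.ModEq.mul_left_cancel' hN.ne' h2
    have : e = f ∧ f = g := by
      interval_cases e <;> interval_cases f <;> interval_cases g <;> omega
    obtain ⟨rfl, rfl⟩ := this
    exact ⟨rfl, rfl⟩
  · intro x
    obtain ⟨y, hy, z, hz, hzy, hx⟩ := h.cover x
    obtain ⟨t, ht⟩ := (Nat.modEq_iff_dvd.1 hx)
    push_cast at ht
    have key : ∀ d e : ℕ, d < 2 → e < 2 → e ≤ d → (3 : ℤ) ∣ 2 * d - e + t →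
        ∃ y ∈ A ∪ A.image (N + ·), ∃ z ∈ A ∪ A.image (N + ·),
          z ≤ y ∧ x + z ≡ 2 * y [MOD 3 * N] := by
      rintro d e hd he hed ⟨k, hk⟩
      refine ⟨y + N * d, (hmem _).2 ⟨y, hy, d, hd, rfl⟩, z + N * e,
        (hmem _).2 ⟨z, hz, e, he, rfl⟩, add_le_add hzy (Nat.mul_le_mul_left N hed),
        Nat.modEq_iff_dvd.2 ⟨k, ?_⟩⟩
      push_cast
      linear_combination ht + (N : ℤ) * hk
    have hr : t % 3 = 0 ∨ t % 3 = 1 ∨ t % 3 = 2 := by omega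
    rcases hr with hr | hr | hr
    · exact key 0 0 (by norm_num) (by norm_num) le_rfl (by push_cast; omega)
    · exact key 1 0 (by norm_num) (by norm_num) (by norm_num) (by push_cast; omega)
    · exact key 1 1 (by norm_num) (by norm_num) le_rfl (by push_cast; omega)

theorem exists_triple_iterate (h : NearModularWithMax A N M s) (n : ℕ) :
    ∃ B M', NearModularWithMax B (3 ^ n * N) M' (s + n) ∧ 2 * M' + N = 2 * M + 3 ^ n * N := by
  induction n with
  | zero => exact ⟨A, M, by simpa using h, by simp⟩
  | succ n ih =>
    obtain ⟨B, M', hB, hM'⟩ := ih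
    have h' := hB.triple
    rw [← mul_assoc, ← pow_succ'] at h'
    refine ⟨_, _, h', ?_⟩
    rw [pow_succ]
    linarith

/-- The integers with residue in `A` modulo `N` and quotient having only ternary digits `0`, `1`. -/
def extension (A : Finset ℕ) (N : ℕ) : Set ℕ :=
  {x | x % N ∈ A ∧ TernaryBinary (x / N)}

theorem add_mul_mem_extension (h : NearModularWithMax A N M s) (hMN : M < N) {a d : ℕ}
    (ha : a ∈ A) (hd : TernaryBinary d) : a + N * d ∈ extension A N := by
  have haN : a < N := lt_of_le_of_lt (h.le_max a ha) hMN
  refine ⟨?_, ?_⟩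
  · rwa [Nat.add_mul_mod_self_left, Nat.mod_eq_of_lt haN]
  · rwa [Nat.add_mul_div_left _ _ h.pos, Nat.div_eq_of_lt haN, zero_add]

theorem threeAPFree_extension (h : NearModularWithMax A N M s) :
    ThreeAPFree (extension A N) := by
  rintro x ⟨hx, hx'⟩ y ⟨hy, hy'⟩ z ⟨hz, hz'⟩ hxyz
  have hxyz : x + z = 2 * y := by omega
  have hmod : x % N + z % N ≡ 2 * (y % N) [MOD N] :=
    (((Nat.mod_modEq x N).add (Nat.mod_modEq z N)).trans (by rw [hxyz])).trans
      ((Nat.mod_modEq y N).mul_left 2).symm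
  obtain ⟨h1, h2⟩ := h.free _ hx _ hy _ hz hmod
  have ex := Nat.mod_add_div x N
  have ey := Nat.mod_add_div y N
  have ez := Nat.mod_add_div z N
  have hq : x / N + z / N = 2 * (y / N) := by
    apply Nat.eq_of_mul_eq_mul_left h.pos
    linarith
  have := TernaryBinary.eq_of_add_eq_two_mul _ _ _ hx' hy' hz' hq
  rw [← ex, ← ey, this, h1]

theorem exists_add_eq_two_mul (h : NearModularWithMax A N M s) (hMN : M < N) {x : ℕ}
    (hx : N ≤ x) : ∃ y ∈ extension A N, ∃ z ∈ extension A N, z ≤ y ∧ x + z = 2 * y := by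
  obtain ⟨y, hy, z, hz, hzy, hxyz⟩ := h.cover x
  have hyN : y < N := lt_of_le_of_lt (h.le_max y hy) hMN
  obtain ⟨t, ht⟩ := Nat.modEq_iff_dvd.1 hxyz.symm
  push_cast at ht
  have ht0 : 0 ≤ t := by
    by_contra! hneg
    have h1 : (N : ℤ) * t ≤ (N : ℤ) * (-1) :=
      mul_le_mul_of_nonneg_left (by omega) (by positivity)
    omega
  lift t to ℕ using ht0
  obtain ⟨d, e, hd, he, hed, hq⟩ := TernaryBinary.exists_add_eq_two_mul t
  refine ⟨_, h.add_mul_mem_extension hMN hy hd, _, h.add_mul_mem_extension hMN hz he,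
    add_le_add hzy (Nat.mul_le_mul_left N hed), ?_⟩
  zify at hq ⊢
  linear_combination ht + (N : ℤ) * hq

theorem pow_mul_add_mem_extension_iff (h : NearModularWithMax A N M s) {n y : ℕ}
    (hy : y < N * 3 ^ n) : N * 3 ^ n + y ∈ extension A N ↔ y ∈ extension A N := by
  have hq : y / N < 3 ^ n := Nat.div_lt_of_lt_mul hy
  simp only [extension, Set.mem_ofPred_eq, Nat.mul_add_mod, Nat.mul_add_div h.pos,
    TernaryBinary.pow_add_iff n _ hq]

theorem not_mem_extension (h : NearModularWithMax A N M s) {n x : ℕ}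
    (hx : 2 * (N * 3 ^ n) ≤ x) (hx' : x < N * 3 ^ (n + 1)) : x ∉ extension A N := by
  rintro ⟨-, hd⟩
  have h1 := hd.two_mul_lt (Nat.div_lt_of_lt_mul hx')
  have h2 : 2 * 3 ^ n ≤ x / N := (Nat.le_div_iff_mul_le h.pos).2 (by linarith)
  rw [pow_succ] at h1
  have : 0 < 3 ^ n := by positivity
  omega

theorem count_extension [DecidablePred (· ∈ extension A N)] (h : NearModularWithMax A N M s)
    (hMN : M < N) (n : ℕ) :
    Nat.count (· ∈ extension A N) (N * 3 ^ n) = 2 ^ (s + n) := by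
  induction n with
  | zero =>
    rw [pow_zero, mul_one, add_zero, Nat.count_eq_card_filter_range, ← h.card_eq]
    congr 1
    ext x
    rw [Finset.mem_filter, Finset.mem_range]
    constructor
    · rintro ⟨hx, hx', -⟩
      rwa [Nat.mod_eq_of_lt hx] at hx'
    · intro hx
      refine ⟨lt_of_le_of_lt (h.le_max x hx) hMN, ?_⟩
      simpa using h.add_mul_mem_extension hMN hx TernaryBinary.zero
  | succ n ih =>
    have e : N * 3 ^ (n + 1) = N * 3 ^ n + N * 3 ^ n + N * 3 ^ n := by ring
    have h1 : Nat.count (fun k => N * 3 ^ n + k ∈ extension A N) (N * 3 ^ n) =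
        Nat.count (· ∈ extension A N) (N * 3 ^ n) := by
      rw [Nat.count_eq_card_filter_range, Nat.count_eq_card_filter_range]
      congr 1
      refine Finset.filter_congr fun x hx => ?_
      exact h.pow_mul_add_mem_extension_iff (Finset.mem_range.1 hx)
    have h2 : Nat.count (fun k => N * 3 ^ n + N * 3 ^ n + k ∈ extension A N) (N * 3 ^ n) = 0 := by
      rw [Nat.count_eq_card_filter_range, Finset.card_eq_zero, Finset.filter_eq_empty_iff]
      intro x hx
      have := Finset.mem_range.1 hx
      exact h.not_mem_extension (n := n) (by omega) (by omega)
    rw [e, Nat.count_add, Nat.count_add, h1, h2, ih, ← add_assoc, pow_succ]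
    ring

theorem exists_last (h : NearModularWithMax A N M s) (hMN : M < N) (n : ℕ) :
    ∃ w ∈ extension A N, w < N * 3 ^ n ∧ 2 * w + N = 2 * M + N * 3 ^ n ∧
      ∀ x ∈ extension A N, x < N * 3 ^ n → x ≤ w := by
  induction n with
  | zero =>
    refine ⟨M, ?_, by simpa using hMN, by simp, ?_⟩
    · simpa using h.add_mul_mem_extension hMN h.max_mem TernaryBinary.zero
    · rintro x ⟨hx, -⟩ hxN
      rw [pow_zero, mul_one] at hxN
      rw [Nat.mod_eq_of_lt hxN] at hx
      exact h.le_max x hx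
  | succ n ih =>
    obtain ⟨w, hw, hwlt, hw2, hmax⟩ := ih
    have e : N * 3 ^ (n + 1) = N * 3 ^ n + N * 3 ^ n + N * 3 ^ n := by ring
    refine ⟨N * 3 ^ n + w, (h.pow_mul_add_mem_extension_iff hwlt).2 hw, by omega, by omega, ?_⟩
    intro x hx hxlt
    by_cases h1 : x < N * 3 ^ n
    · omega
    · by_cases h2 : 2 * (N * 3 ^ n) ≤ x
      · exact absurd hx (h.not_mem_extension h2 hxlt)
      · obtain ⟨y, rfl⟩ := Nat.exists_eq_add_of_le (not_lt.1 h1)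
        have hy : y < N * 3 ^ n := by omega
        have := hmax y ((h.pow_mul_add_mem_extension_iff hy).1 hx) hy
        omega

theorem infinite_extension (h : NearModularWithMax A N M s) (hMN : M < N) :
    (extension A N).Infinite := by
  refine Set.infinite_of_forall_exists_gt fun b => ?_
  have hd : TernaryBinary (3 ^ b) := by
    simpa using (TernaryBinary.pow_add_iff b 0 (by positivity)).2 TernaryBinary.zero
  refine ⟨_, h.add_mul_mem_extension hMN h.zero_mem hd, ?_⟩
  have h1 : b < 3 ^ b := Nat.lt_pow_self (by norm_num)
  have h2 : 1 * 3 ^ b ≤ N * 3 ^ b := Nat.mul_le_mul_right _ h.pos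
  omega

theorem isIndependent_nth (h : NearModularWithMax A N M s) (hMN : M < N) {lam : ℕ}
    (hlam : lam + N = 2 * M + 1) : IsIndependent (Nat.nth (· ∈ extension A N)) lam := by
  classical
  have hinf := h.infinite_extension hMN
  refine ⟨s, fun k hk => ?_⟩
  obtain ⟨n, rfl⟩ := Nat.exists_eq_add_of_le hk
  have hcount := h.count_extension hMN n
  have hpos : 0 < N * 3 ^ n := Nat.mul_pos h.pos (by positivity)
  have hzero : 0 ∈ extension A N := by
    simpa using h.add_mul_mem_extension hMN h.zero_mem TernaryBinary.zero
  have hblock : ∀ y ∈ extension A N, y < N * 3 ^ n →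
      Nat.nth (· ∈ extension A N) (2 ^ (s + n) + Nat.count (· ∈ extension A N) y) =
        N * 3 ^ n + y := by
    intro y hy hylt
    have hc : Nat.count (· ∈ extension A N) (N * 3 ^ n + y) =
        2 ^ (s + n) + Nat.count (· ∈ extension A N) y := by
      rw [Nat.count_add, hcount, Nat.count_eq_card_filter_range,
        Nat.count_eq_card_filter_range]
      congr 2
      refine Finset.filter_congr fun x hx => ?_
      exact h.pow_mul_add_mem_extension_iff ((Finset.mem_range.1 hx).trans hylt)
    rw [← hc]
    exact Nat.nth_count (p := (· ∈ extension A N))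
      ((h.pow_mul_add_mem_extension_iff hylt).2 hy)
  have hfirst : Nat.nth (· ∈ extension A N) (2 ^ (s + n)) = N * 3 ^ n := by
    simpa using hblock 0 hzero hpos
  refine ⟨fun i hi => ?_, ?_⟩
  · have hmem : Nat.nth (· ∈ extension A N) i ∈ extension A N := Nat.nth_mem_of_infinite hinf i
    have hlt : Nat.nth (· ∈ extension A N) i < N * 3 ^ n := by
      rw [← hfirst]
      exact (Nat.nth_lt_nth hinf).2 hi
    have := hblock _ hmem hlt
    rwa [Nat.count_nth_of_infinite (p := (· ∈ extension A N)) hinf, ← hfirst] at this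
  · obtain ⟨w, hw, hwlt, hw2, hmax⟩ := h.exists_last hMN n
    have hcw : Nat.count (· ∈ extension A N) w + 1 = 2 ^ (s + n) := by
      obtain ⟨g, hg⟩ := Nat.exists_eq_add_of_lt hwlt
      rw [← hcount, show N * 3 ^ n = (w + 1) + g by omega, Nat.count_add (a := w + 1),
        Nat.count_succ, if_pos hw, Nat.left_eq_add, Nat.count_eq_card_filter_range,
        Finset.card_eq_zero, Finset.filter_eq_empty_iff]
      intro x hx hxT
      have := Finset.mem_range.1 hx
      have := hmax _ hxT (by omega)
      omega
    have hlast : Nat.nth (· ∈ extension A N) (2 ^ (s + n) - 1) = w := by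
      rw [← hcw, Nat.add_sub_cancel]
      exact Nat.nth_count (p := (· ∈ extension A N)) hw
    rw [hfirst, hlast]
    omega

theorem isCharacter_of_lt (h : NearModularWithMax A N M s) (hMN : M < N) {lam : ℕ}
    (hlam : lam + N = 2 * M + 1) : IsCharacter lam := by
  classical
  have hfree := h.threeAPFree_extension
  have hN : N ∈ extension A N := by
    simpa using h.add_mul_mem_extension hMN h.zero_mem TernaryBinary.zero.append_one
  have hset : stanleySet ((Finset.range (N + 1)).filter (· ∈ extension A N)) =
      extension A N := by
    refine stanleySet_eq_of_covered hfree (h.infinite_extension hMN) (c := N) ?_ hN ?_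
    · intro x
      rw [Finset.mem_filter, Finset.mem_range, Nat.lt_succ_iff, and_comm]
    · intro x hx hxT
      obtain ⟨y, hy, z, hz, hzy, hxyz⟩ := h.exists_add_eq_two_mul hMN hx.le
      refine ⟨y, hy, z, hz, lt_of_le_of_ne hzy ?_, hxyz⟩
      rintro rfl
      obtain rfl : x = z := by omega
      exact hxT hy
  refine ⟨(Finset.range (N + 1)).filter (· ∈ extension A N), ?_, ?_, ?_⟩
  · refine Finset.mem_filter.2 ⟨by simp, ?_⟩
    simpa using h.add_mul_mem_extension hMN h.zero_mem TernaryBinary.zero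
  · exact hfree.mono fun x hx => (Finset.mem_filter.1 hx).2
  · have hseq : stanleySeq ((Finset.range (N + 1)).filter (· ∈ extension A N)) =
        Nat.nth (· ∈ extension A N) := by
      funext n
      rw [stanleySeq, hset]
    rw [hseq]
    exact h.isIndependent_nth hMN hlam

theorem isCharacter (h : NearModularWithMax A N M s) {lam : ℕ}
    (hlam : lam + N = 2 * M + 1) : IsCharacter lam := by
  obtain ⟨B, M', hB, hM'⟩ := h.exists_triple_iterate (2 * M)
  have hlt : 2 * M < 3 ^ (2 * M) := Nat.lt_pow_self (by norm_num)
  have hle : 3 ^ (2 * M) * 1 ≤ 3 ^ (2 * M) * N := Nat.mul_le_mul_left _ h.pos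
  have := h.pos
  exact hB.isCharacter_of_lt (by omega) (by omega)

theorem isCharacter_add (h : NearModularWithMax A N M s) (hM : 0 < M) (l : ℕ) {lam : ℕ}
    (hlam : lam + N = 2 * (M + N * l) + 1) : IsCharacter lam :=
  (h.shift_max hM l).isCharacter hlam

theorem of_bitMask {L : List ℕ} (hN : 0 < N) (h0 : 0 ∈ L) (hM : M ∈ L ∧ ∀ a ∈ L, a ≤ M)
    (hcard : L.Nodup ∧ L.length = 2 ^ s)
    (hfree : bitMask (L.map (· % N)) &&& bitMask (thirdTerms (fun y z => y != z) L N) = 0)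
    (hcover : bitMask (thirdTerms (fun y z => z.ble y) L N) = 2 ^ N - 1) :
    NearModularWithMax L.toFinset N M s := by
  have hthird : ∀ x y z : ℕ, x + z ≡ 2 * y [MOD N] ↔ x % N = (2 * y + (N - 1) * z) % N := by
    intro x y z
    obtain ⟨n, rfl⟩ := Nat.exists_eq_succ_of_ne_zero hN.ne'
    have h1 : 2 * y + n * z + z ≡ 2 * y [MOD n + 1] := by
      rw [add_assoc, ← Nat.succ_mul]
      simp [Nat.ModEq]
    exact ⟨fun h => Nat.ModEq.add_right_cancel' z (h.trans h1.symm),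
      fun h => (Nat.ModEq.add_right z h).trans h1⟩
  have hne : ∀ x ∈ L, ∀ y ∈ L, ∀ z ∈ L, x + z ≡ 2 * y [MOD N] → y = z := by
    intro x hx y hy z hz h
    by_contra hyz
    have h1 : (bitMask (L.map (· % N))).testBit (x % N) = true :=
      testBit_bitMask.2 (List.mem_map_of_mem hx)
    have h2 : (bitMask (thirdTerms (fun y z => y != z) L N)).testBit (x % N) = true :=
      testBit_bitMask.2 (mem_thirdTerms.2 ⟨y, hy, z, hz, by simpa using hyz, (hthird x y z).1 h⟩)
    have := congrArg (fun m => Nat.testBit m (x % N)) hfree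
    simp [h1, h2] at this
  simp only [← List.mem_toFinset] at h0 hM hne
  refine ⟨hN, h0, hM.1, hM.2, ?_, fun x hx y hy z hz h => ?_, fun x => ?_⟩
  · rw [List.toFinset_card_of_nodup hcard.1, hcard.2]
  · obtain rfl := hne x hx y hy z hz h
    refine ⟨(hne x hx y hy x hx ?_).symm, rfl⟩
    have hxy : x ≡ y [MOD N] := Nat.ModEq.add_right_cancel' y (by rwa [← two_mul y])
    rw [two_mul]
    exact hxy.add hxy
  · have hx : (bitMask (thirdTerms (fun y z => z.ble y) L N)).testBit (x % N) = true := by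
      rw [hcover, Nat.testBit_two_pow_sub_one]
      simpa using Nat.mod_lt x hN
    obtain ⟨y, hy, z, hz, hzy, h⟩ := mem_thirdTerms.1 (testBit_bitMask.1 hx)
    exact ⟨y, List.mem_toFinset.2 hy, z, List.mem_toFinset.2 hz, Nat.le_of_ble_eq_true hzy,
      (hthird x y z).2 h⟩

end NearModularWithMax

theorem nearModularWithMax_9_6 :
    NearModularWithMax
      [0, 2, 5, 6].toFinset 9 6 2 :=
  .of_bitMask (by decide) (by decide) (by decide) (by decide)
    (by decide +kernel) (by decide +kernel)

theorem nearModularWithMax_9_12 :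
    NearModularWithMax
      [0, 1, 4, 12].toFinset 9 12 2 :=
  .of_bitMask (by decide) (by decide) (by decide) (by decide)
    (by decide +kernel) (by decide +kernel)

theorem nearModularWithMax_27_18 :
    NearModularWithMax
      [0, 1, 4, 6, 10, 13, 15, 18].toFinset 27 18 3 :=
  .of_bitMask (by decide) (by decide) (by decide) (by decide)
    (by decide +kernel) (by decide +kernel)

theorem nearModularWithMax_27_36 :
    NearModularWithMax
      [0, 1, 3, 4, 10, 13, 21, 36].toFinset 27 36 3 :=
  .of_bitMask (by decide) (by decide) (by decide) (by decide)
    (by decide +kernel) (by decide +kernel)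

theorem nearModularWithMax_81_54 :
    NearModularWithMax
      [0, 1, 3, 4, 10, 13, 18, 21, 28, 30, 31, 37, 40, 45, 48, 54].toFinset
      81 54 4 :=
  .of_bitMask (by decide) (by decide) (by decide) (by decide)
    (by decide +kernel) (by decide +kernel)

theorem nearModularWithMax_81_108 :
    NearModularWithMax
      [0, 1, 3, 4, 9, 10, 12, 13, 28, 36, 37, 57, 58, 66, 67, 108].toFinset
      81 108 4 :=
  .of_bitMask (by decide) (by decide) (by decide) (by decide)
    (by decide +kernel) (by decide +kernel)

theorem nearModularWithMax_243_162 :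
    NearModularWithMax
      [0, 1, 3, 4, 9, 19, 22, 30, 36, 46, 48, 49, 54, 55, 58, 75, 82, 84, 85, 90, 100, 103,
      111, 117, 127, 129, 130, 135, 136, 139, 156, 162].toFinset
      243 162 5 :=
  .of_bitMask (by decide) (by decide) (by decide) (by decide)
    (by decide +kernel) (by decide +kernel)

theorem nearModularWithMax_243_324 :
    NearModularWithMax
      [0, 1, 3, 4, 9, 10, 12, 13, 27, 28, 30, 31, 36, 37, 39, 40, 82, 85, 90, 93, 94, 109,
      112, 117, 120, 121, 165, 172, 189, 192, 199, 324].toFinset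
      243 324 5 :=
  .of_bitMask (by decide) (by decide) (by decide) (by decide)
    (by decide +kernel) (by decide +kernel)

/-- For `i ∈ {1,2,3,4}` and every `l ≥ 0`, both `3^i + 1 + 2l·3^(i+1)` and
`5·3^i + 1 + 2l·3^(i+1)` are characters of independent Stanley sequences. -/
theorem character_residue_families (i : ℕ) (hi : i ∈ ({1, 2, 3, 4} : Set ℕ)) (l : ℕ) :
    IsCharacter (3 ^ i + 1 + 2 * l * 3 ^ (i + 1)) ∧
    IsCharacter (5 * 3 ^ i + 1 + 2 * l * 3 ^ (i + 1)) := by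
  rcases hi with rfl | rfl | rfl | rfl
  · exact ⟨nearModularWithMax_9_6.isCharacter_add (by norm_num) l (by ring),
      nearModularWithMax_9_12.isCharacter_add (by norm_num) l (by ring)⟩
  · exact ⟨nearModularWithMax_27_18.isCharacter_add (by norm_num) l (by ring),
      nearModularWithMax_27_36.isCharacter_add (by norm_num) l (by ring)⟩
  · exact ⟨nearModularWithMax_81_54.isCharacter_add (by norm_num) l (by ring),
      nearModularWithMax_81_108.isCharacter_add (by norm_num) l (by ring)⟩
  · exact ⟨nearModularWithMax_243_162.isCharacter_add (by norm_num) l (by ring),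
      nearModularWithMax_243_324.isCharacter_add (by norm_num) l (by ring)⟩
end

section
/- Let λ be a nonnegative integer with λ ≡ 4 (mod 6) and λ ≢ 244 (mod 486). Then there exist i ∈ {1, 2, 3, 4} and a nonnegative integer ℓ such that λ = 3^i + 1 + 2ℓ·3^{i+1} or λ = 5·3^i + 1 + 2ℓ·3^{i+1}. -/
/-- Every `lam ≡ 4 (mod 6)` with `lam ≢ 244 (mod 486)` has the form
`3^i + 1 + 2l·3^(i+1)` or `5·3^i + 1 + 2l·3^(i+1)` for some `i ∈ {1,2,3,4}`, `l ≥ 0`. -/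
theorem four_mod_six_covering (lam : ℕ) (h6 : lam % 6 = 4) (h486 : lam % 486 ≠ 244) :
    ∃ i ∈ ({1, 2, 3, 4} : Set ℕ), ∃ l : ℕ,
      lam = 3 ^ i + 1 + 2 * l * 3 ^ (i + 1) ∨
      lam = 5 * 3 ^ i + 1 + 2 * l * 3 ^ (i + 1) := by
  rcases (by omega : lam % 18 = 4 ∨ lam % 18 = 16 ∨ lam % 54 = 10 ∨ lam % 54 = 46 ∨
      lam % 162 = 28 ∨ lam % 162 = 136 ∨ lam % 486 = 82 ∨ lam % 486 = 406) with
    h | h | h | h | h | h | h | h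
  · exact ⟨1, by simp, lam / 18, Or.inl (by omega)⟩
  · exact ⟨1, by simp, lam / 18, Or.inr (by omega)⟩
  · exact ⟨2, by simp, lam / 54, Or.inl (by omega)⟩
  · exact ⟨2, by simp, lam / 54, Or.inr (by omega)⟩
  · exact ⟨3, by simp, lam / 162, Or.inl (by omega)⟩
  · exact ⟨3, by simp, lam / 162, Or.inr (by omega)⟩
  · exact ⟨4, by simp, lam / 486, Or.inl (by omega)⟩
  · exact ⟨4, by simp, lam / 486, Or.inr (by omega)⟩
end

section
/- The set of nonnegative integers that occur as the character of some independent Stanley sequence has lower asymptotic density at least 121/243; in particular it has positive lower density. -/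
/-! ### Recognising a Stanley sequence -/

/-- An infinite 3-AP-free set such that every missing integer beyond its `c`-th element completes
a progression of smaller elements is generated greedily from its first `c` elements. -/
theorem stanleySet_image_nth {S : Set ℕ} (hinf : S.Infinite) (hfree : ThreeAPFree S) {c : ℕ}
    (hc : 0 < c)
    (hcov : ∀ x, Nat.nth (· ∈ S) (c - 1) < x → x ∉ S →
      ∃ y ∈ S, ∃ z ∈ S, z < y ∧ y < x ∧ x + z = y + y) :
    stanleySet ((Finset.range c).image (Nat.nth (· ∈ S))) = S := by
  have hinf' : {x | x ∈ S}.Infinite := hinf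
  have hmem : ∀ n, Nat.nth (· ∈ S) n ∈ S := fun n => Nat.nth_mem_of_infinite hinf' n
  have hmono : StrictMono (Nat.nth (· ∈ S)) := Nat.nth_strictMono hinf'
  have hsurj : ∀ x ∈ S, ∃ n, Nat.nth (· ∈ S) n = x := fun x hx => by
    classical
    exact ⟨_, Nat.nth_count (p := (· ∈ S)) hx⟩
  have hnext : ∀ n, c ≤ n →
      stanleyNext ((Finset.range n).image (Nat.nth (· ∈ S))) = Nat.nth (· ∈ S) n := by
    intro n hn
    apply IsLeast.csInf_eq
    constructor
    · constructor
      · intro s hs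
        obtain ⟨i, hi, rfl⟩ := Finset.mem_image.1 hs
        exact hmono (Finset.mem_range.1 hi)
      · apply hfree.mono
        intro x hx
        rcases hx with rfl | hx
        · exact hmem n
        · obtain ⟨i, -, rfl⟩ := Finset.mem_image.1 hx
          exact hmem i
    · rintro w ⟨hw, hwfree⟩
      by_contra! hlt
      have hbelow : ∀ y ∈ S, y ≤ w → y ∈ (Finset.range n).image (Nat.nth (· ∈ S)) := by
        intro y hy hyw
        obtain ⟨i, rfl⟩ := hsurj y hy
        exact Finset.mem_image.2
          ⟨i, Finset.mem_range.2 (hmono.lt_iff_lt.1 (hyw.trans_lt hlt)), rfl⟩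
      have hwS : w ∉ S := fun h => lt_irrefl _ (hw w (hbelow w h le_rfl))
      have hcw : Nat.nth (· ∈ S) (c - 1) < w :=
        hw _ (Finset.mem_image.2 ⟨c - 1, Finset.mem_range.2 (by omega), rfl⟩)
      obtain ⟨y, hy, z, hz, hzy, hyw, h⟩ := hcov w hcw hwS
      have := hwfree (Set.mem_insert _ _)
        (Set.mem_insert_of_mem _ (Finset.mem_coe.2 (hbelow y hy hyw.le)))
        (Set.mem_insert_of_mem _ (Finset.mem_coe.2 (hbelow z hz (hzy.trans hyw).le))) h
      omega
  have hiter : ∀ n, stanleyIter ((Finset.range c).image (Nat.nth (· ∈ S))) n =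
      (Finset.range (c + n)).image (Nat.nth (· ∈ S)) := by
    intro n
    induction n with
    | zero => rfl
    | succ n ih =>
      rw [stanleyIter, ih, hnext _ (by omega), ← add_assoc, Finset.range_add_one,
        Finset.image_insert]
  ext x
  simp only [stanleySet, Set.mem_iUnion, hiter, Finset.mem_coe, Finset.mem_image,
    Finset.mem_range]
  constructor
  · rintro ⟨n, i, -, rfl⟩
    exact hmem i
  · intro hx
    obtain ⟨i, rfl⟩ := hsurj x hx
    exact ⟨i + 1, i, by omega, rfl⟩

/-! ### Reading binary expansions in base three -/

/-- The integer whose base-three digits are the binary digits of `n`. -/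
def binaryToTernary : ℕ → ℕ
  | 0 => 0
  | n + 1 => 3 * binaryToTernary ((n + 1) / 2) + (n + 1) % 2
decreasing_by omega

theorem binaryToTernary_zero : binaryToTernary 0 = 0 := by rw [binaryToTernary]

theorem binaryToTernary_eq (n : ℕ) :
    binaryToTernary n = 3 * binaryToTernary (n / 2) + n % 2 := by
  cases n with
  | zero => simp [binaryToTernary_zero]
  | succ n => rw [binaryToTernary]

theorem binaryToTernary_strictMono : StrictMono binaryToTernary := by
  intro a b
  induction b using Nat.strong_induction_on generalizing a with
  | _ b ih =>
    intro hab
    rw [binaryToTernary_eq a, binaryToTernary_eq b]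
    rcases (show a / 2 < b / 2 ∨ a / 2 = b / 2 ∧ a % 2 < b % 2 by omega) with h | ⟨h, h'⟩
    · have := ih (b / 2) (by omega) h
      omega
    · rw [h]
      omega

theorem binaryToTernary_two_pow_add (j i : ℕ) (hi : i < 2 ^ j) :
    binaryToTernary (2 ^ j + i) = 3 ^ j + binaryToTernary i := by
  induction j generalizing i with
  | zero =>
    obtain rfl : i = 0 := by simpa using hi
    rw [binaryToTernary_eq]
    simp [binaryToTernary_zero]
  | succ j ih =>
    rw [pow_succ] at hi
    rw [binaryToTernary_eq, binaryToTernary_eq i, pow_succ,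
      show (2 ^ j * 2 + i) / 2 = 2 ^ j + i / 2 by omega, ih _ (by omega)]
    omega

theorem binaryToTernary_two_pow (j : ℕ) : binaryToTernary (2 ^ j) = 3 ^ j := by
  simpa [binaryToTernary_zero] using binaryToTernary_two_pow_add j 0 (by positivity)

theorem two_mul_binaryToTernary_two_pow_sub_one (j : ℕ) :
    2 * binaryToTernary (2 ^ j - 1) + 1 = 3 ^ j := by
  induction j with
  | zero => simp [binaryToTernary_zero]
  | succ j ih =>
    have : 0 < 2 ^ j := by positivity
    rw [binaryToTernary_eq, pow_succ, pow_succ,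
      show (2 ^ j * 2 - 1) / 2 = 2 ^ j - 1 by omega]
    omega

theorem binaryToTernary_threeAP {a b c : ℕ}
    (h : binaryToTernary a + binaryToTernary c = 2 * binaryToTernary b) : a = b ∧ b = c := by
  induction hn : a + b + c using Nat.strong_induction_on generalizing a b c with
  | _ n ih =>
    by_cases h0 : n = 0
    · omega
    · rw [binaryToTernary_eq a, binaryToTernary_eq b, binaryToTernary_eq c] at h
      have := ih (a / 2 + b / 2 + c / 2) (by omega) (a := a / 2) (b := b / 2) (c := c / 2)
        (by omega) rfl
      omega

theorem exists_binaryToTernary_two_mul_sub (q : ℕ) :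
    ∃ d e, e ≤ d ∧ q + binaryToTernary e = 2 * binaryToTernary d := by
  induction q using Nat.strong_induction_on with
  | _ q ih =>
    by_cases h0 : q = 0
    · exact ⟨0, 0, le_rfl, by simp [h0, binaryToTernary_zero]⟩
    · obtain ⟨d, e, hed, h⟩ := ih (q / 3) (by omega)
      have key : ∀ x b, b < 2 → binaryToTernary (2 * x + b) = 3 * binaryToTernary x + b := by
        intro x b hb
        rw [binaryToTernary_eq, show (2 * x + b) / 2 = x by omega]
        omega
      rcases (show q % 3 = 0 ∨ q % 3 = 1 ∨ q % 3 = 2 by omega) with hq | hq | hq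
      · refine ⟨2 * d + 0, 2 * e + 0, by omega, ?_⟩
        rw [key _ _ (by omega), key _ _ (by omega)]
        omega
      · refine ⟨2 * d + 1, 2 * e + 1, by omega, ?_⟩
        rw [key _ _ (by omega), key _ _ (by omega)]
        omega
      · refine ⟨2 * d + 1, 2 * e + 0, by omega, ?_⟩
        rw [key _ _ (by omega), key _ _ (by omega)]
        omega

/-! ### Stanley sequences from near-modular sets -/

/-- The sums of an element of `A` and `N` times an integer with base-three digits `0` and `1`. -/
def ternaryExtension (A : Finset ℕ) (N : ℕ) : Set ℕ :=
  {x | ∃ a ∈ A, ∃ i, x = a + N * binaryToTernary i}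

section

variable {A : Finset ℕ} {N M : ℕ}

theorem add_mul_binaryToTernary_threeAP (hN : 0 < N)
    (hfree : ∀ x ∈ A, ∀ y ∈ A, ∀ z ∈ A, (x + z) % N = (2 * y) % N → x = y ∧ y = z)
    {a b c i j k : ℕ} (ha : a ∈ A) (hb : b ∈ A) (hc : c ∈ A)
    (h : (a + N * binaryToTernary i) + (c + N * binaryToTernary k) =
      2 * (b + N * binaryToTernary j)) : (a = b ∧ b = c) ∧ i = j ∧ j = k := by
  have habc : a = b ∧ b = c := by
    apply hfree a ha b hb c hc
    have h' := congrArg (· % N) h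
    rwa [show a + N * binaryToTernary i + (c + N * binaryToTernary k) =
        (a + c) + N * (binaryToTernary i + binaryToTernary k) by ring,
      show 2 * (b + N * binaryToTernary j) = 2 * b + N * (2 * binaryToTernary j) by ring,
      Nat.add_mul_mod_self_left, Nat.add_mul_mod_self_left] at h'
  refine ⟨habc, binaryToTernary_threeAP (Nat.eq_of_mul_eq_mul_left hN ?_)⟩
  obtain ⟨rfl, rfl⟩ := habc
  linarith

theorem add_mul_binaryToTernary_lt_iff (hM : ∀ a ∈ A, a ≤ M) {j : ℕ} (hj : 2 * M < N * 3 ^ j)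
    {a i : ℕ} (ha : a ∈ A) : a + N * binaryToTernary i < N * 3 ^ j ↔ i < 2 ^ j := by
  constructor
  · intro h
    by_contra! hi
    have h1 := binaryToTernary_strictMono.monotone hi
    rw [binaryToTernary_two_pow] at h1
    have := Nat.mul_le_mul_left N h1
    omega
  · intro hi
    have h1 := binaryToTernary_strictMono.monotone (show i ≤ 2 ^ j - 1 by omega)
    have h2 := two_mul_binaryToTernary_two_pow_sub_one j
    have h3 := Nat.mul_le_mul_left N (show 2 * binaryToTernary i + 1 ≤ 3 ^ j by omega)
    have := hM a ha
    nlinarith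

theorem mul_three_pow_add_mem_ternaryExtension (hM : ∀ a ∈ A, a ≤ M) {j : ℕ}
    (hj : 2 * M < N * 3 ^ j) {y : ℕ} (hy : y < N * 3 ^ j) :
    N * 3 ^ j + y ∈ ternaryExtension A N ↔ y ∈ ternaryExtension A N := by
  constructor
  · rintro ⟨a, ha, i, hi⟩
    have h1 : ¬ i < 2 ^ j := by
      rw [← add_mul_binaryToTernary_lt_iff hM hj ha]
      omega
    have h2 : i < 2 ^ (j + 1) := by
      rw [← add_mul_binaryToTernary_lt_iff (N := N) hM (by rw [pow_succ, ← mul_assoc]; omega) ha,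
        pow_succ, ← mul_assoc]
      omega
    rw [pow_succ] at h2
    have h3 := binaryToTernary_two_pow_add j (i - 2 ^ j) (by omega)
    rw [show 2 ^ j + (i - 2 ^ j) = i by omega] at h3
    refine ⟨a, ha, i - 2 ^ j, ?_⟩
    rw [h3, mul_add] at hi
    omega
  · rintro ⟨a, ha, i, rfl⟩
    refine ⟨a, ha, 2 ^ j + i, ?_⟩
    rw [binaryToTernary_two_pow_add j i ((add_mul_binaryToTernary_lt_iff hM hj ha).1 hy)]
    ring

open Classical in
theorem count_ternaryExtension (hN : 0 < N) (hM : ∀ a ∈ A, a ≤ M)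
    (hfree : ∀ x ∈ A, ∀ y ∈ A, ∀ z ∈ A, (x + z) % N = (2 * y) % N → x = y ∧ y = z)
    {j : ℕ} (hj : 2 * M < N * 3 ^ j) :
    Nat.count (· ∈ ternaryExtension A N) (N * 3 ^ j) = A.card * 2 ^ j := by
  rw [Nat.count_eq_card_filter_range]
  have himage : {x ∈ Finset.range (N * 3 ^ j) | x ∈ ternaryExtension A N} =
      (A ×ˢ Finset.range (2 ^ j)).image fun p => p.1 + N * binaryToTernary p.2 := by
    ext x
    simp only [Finset.mem_filter, Finset.mem_range, Finset.mem_image, Finset.mem_product,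
      Prod.exists]
    constructor
    · rintro ⟨hx, a, ha, i, rfl⟩
      exact ⟨a, i, ⟨ha, (add_mul_binaryToTernary_lt_iff hM hj ha).1 hx⟩, rfl⟩
    · rintro ⟨a, i, ⟨ha, hi⟩, rfl⟩
      exact ⟨(add_mul_binaryToTernary_lt_iff hM hj ha).2 hi, a, ha, i, rfl⟩
  rw [himage, Finset.card_image_of_injOn, Finset.card_product, Finset.card_range]
  rintro ⟨a, i⟩ hai ⟨b, k⟩ hbk h
  simp only [Finset.coe_product, Set.mem_prod, Finset.mem_coe] at hai hbk h
  obtain ⟨⟨rfl, -⟩, rfl, -⟩ :=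
    add_mul_binaryToTernary_threeAP hN hfree (i := i) (j := k) (k := k) (c := b) hai.1 hbk.1 hbk.1
      (by omega)
  rfl

/-- A near-modular set modulo `N` with largest element `M` and `2 ^ m` elements generates an
independent Stanley sequence of character `2 * M + 1 - N`. -/
theorem isCharacter_of_nearModular {m lam : ℕ} (hN : 0 < N) (h0 : 0 ∈ A) (hMA : M ∈ A)
    (hM : ∀ a ∈ A, a ≤ M) (hcard : A.card = 2 ^ m)
    (hfree : ∀ x ∈ A, ∀ y ∈ A, ∀ z ∈ A, (x + z) % N = (2 * y) % N → x = y ∧ y = z)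
    (hcov : ∀ r, ∃ y ∈ A, ∃ z ∈ A, z ≤ y ∧ (r + z) % N = (2 * y) % N)
    (hlam : lam + N = 2 * M + 1) : IsCharacter lam := by
  classical
  set S := ternaryExtension A N with hS
  have hlarge : ∀ j, M ≤ j → M ≤ binaryToTernary (2 ^ j - 1) ∧ 2 * M < N * 3 ^ j := by
    intro j hj
    have h1 := binaryToTernary_strictMono.le_apply (x := 2 ^ j - 1)
    have h2 := two_mul_binaryToTernary_two_pow_sub_one j
    have h3 : j < 2 ^ j := Nat.lt_two_pow_self
    have h4 := Nat.le_mul_of_pos_left (3 ^ j) hN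
    omega
  have hcount : ∀ j, M ≤ j → Nat.count (· ∈ S) (N * 3 ^ j) = 2 ^ (m + j) := by
    intro j hj
    rw [count_ternaryExtension hN hM hfree (hlarge j hj).2, hcard, pow_add]
  have hpow : ∀ j, N * 3 ^ j ∈ S := fun j =>
    ⟨0, h0, 2 ^ j, by rw [binaryToTernary_two_pow, zero_add]⟩
  have hSfree : ThreeAPFree S := by
    rintro _ ⟨a, ha, i, rfl⟩ _ ⟨b, hb, j, rfl⟩ _ ⟨c, hc, k, rfl⟩ h
    obtain ⟨⟨rfl, -⟩, rfl, -⟩ :=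
      add_mul_binaryToTernary_threeAP hN hfree ha hb hc (h.trans (two_mul _).symm)
    rfl
  have hinf : S.Infinite := by
    apply Set.infinite_of_injective_forall_mem (f := fun j => N * 3 ^ j) _ hpow
    intro i j h
    exact Nat.pow_right_injective (show 2 ≤ 3 by norm_num)
      (Nat.eq_of_mul_eq_mul_left hN h)
  have hinf' : {x | x ∈ S}.Infinite := hinf
  have hlast : ∀ j, M ≤ j →
      Nat.nth (· ∈ S) (2 ^ (m + j) - 1) = M + N * binaryToTernary (2 ^ j - 1) := by
    intro j hj
    have hmem : M + N * binaryToTernary (2 ^ j - 1) ∈ S := ⟨M, hMA, _, rfl⟩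
    have hlt := (add_mul_binaryToTernary_lt_iff hM (hlarge j hj).2 hMA).2
      (Nat.sub_lt (by positivity) one_pos)
    have hc : Nat.count (· ∈ S) (M + N * binaryToTernary (2 ^ j - 1) + 1) = 2 ^ (m + j) := by
      rw [← hcount j hj, Nat.count_eq_card_filter_range, Nat.count_eq_card_filter_range]
      congr 1
      ext x
      simp only [Finset.mem_filter, Finset.mem_range]
      refine and_congr_left fun hx => ⟨fun h => by omega, fun h => ?_⟩
      obtain ⟨a, ha, i, rfl⟩ := hx
      rw [add_mul_binaryToTernary_lt_iff hM (hlarge j hj).2 ha] at h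
      have h1 := Nat.mul_le_mul_left N
        (binaryToTernary_strictMono.monotone (show i ≤ 2 ^ j - 1 by omega))
      have := hM a ha
      omega
    rw [Nat.count_succ, if_pos hmem] at hc
    rw [← hc, Nat.add_sub_cancel]
    exact Nat.nth_count (p := (· ∈ S)) hmem
  have hstanley : stanleySet ((Finset.range (2 ^ (m + M))).image (Nat.nth (· ∈ S))) = S := by
    apply stanleySet_image_nth hinf hSfree (by positivity)
    intro x hx hxS
    rw [hlast M le_rfl] at hx
    have hM2 : 2 * M < x := by
      have := (hlarge M le_rfl).1.trans (Nat.le_mul_of_pos_left _ hN)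
      omega
    obtain ⟨y, hy, z, hz, hzy, hmod⟩ := hcov x
    have hyM := hM y hy
    obtain ⟨q, hq⟩ := (Nat.modEq_iff_dvd' (show 2 * y ≤ x + z by omega)).1 hmod.symm
    obtain ⟨d, e, hed, hde⟩ := exists_binaryToTernary_two_mul_sub q
    have hle := Nat.mul_le_mul_left N (binaryToTernary_strictMono.monotone hed)
    have heq : N * q + N * binaryToTernary e = 2 * (N * binaryToTernary d) := by
      rw [← mul_add, hde]
      ring
    have hyS : y + N * binaryToTernary d ∈ S := ⟨y, hy, d, rfl⟩
    have hne : x ≠ y + N * binaryToTernary d := by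
      rintro rfl
      exact hxS hyS
    exact ⟨_, hyS, z + N * binaryToTernary e, ⟨z, hz, e, rfl⟩, by omega, by omega, by omega⟩
  refine ⟨(Finset.range (2 ^ (m + M))).image (Nat.nth (· ∈ S)), ?_, ?_, m + M, ?_⟩
  · refine Finset.mem_image.2 ⟨0, Finset.mem_range.2 (by positivity), ?_⟩
    exact Nat.nth_zero_of_zero (p := (· ∈ S)) ⟨0, h0, 0, by simp [binaryToTernary_zero]⟩
  · apply hSfree.mono
    intro x hx
    obtain ⟨i, -, rfl⟩ := Finset.mem_image.1 hx
    exact Nat.nth_mem_of_infinite hinf' i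
  · intro k hk
    obtain ⟨j, rfl⟩ : ∃ j, k = m + j := ⟨k - m, by omega⟩
    have hj : M ≤ j := by omega
    have hfirst : Nat.nth (· ∈ S) (2 ^ (m + j)) = N * 3 ^ j := by
      rw [← hcount j hj]
      exact Nat.nth_count (p := (· ∈ S)) (hpow j)
    simp only [stanleySeq, hstanley]
    rw [hfirst, hlast j hj]
    constructor
    · intro i hi
      have hiS : Nat.nth (· ∈ S) i ∈ S := Nat.nth_mem_of_infinite hinf' i
      have hilt : Nat.nth (· ∈ S) i < N * 3 ^ j := by
        rw [← hfirst]
        exact Nat.nth_strictMono hinf' hi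
      have hci : Nat.count (· ∈ S) (N * 3 ^ j + Nat.nth (· ∈ S) i) = 2 ^ (m + j) + i := by
        rw [Nat.count_add, hcount j hj]
        congr 1
        refine Eq.trans ?_ (Nat.count_nth_of_infinite hinf' i)
        rw [Nat.count_eq_card_filter_range, Nat.count_eq_card_filter_range]
        congr 1
        apply Finset.filter_congr
        intro x hx
        exact mul_three_pow_add_mem_ternaryExtension hM (hlarge j hj).2
          ((Finset.mem_range.1 hx).trans hilt)
      rw [← hci]
      exact Nat.nth_count (p := (· ∈ S))
        ((mul_three_pow_add_mem_ternaryExtension hM (hlarge j hj).2 hilt).2 hiS)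
    · have h1 := congrArg (N * ·) (two_mul_binaryToTernary_two_pow_sub_one j)
      simp only [mul_add, mul_one] at h1
      linarith

end

/-! ### Explicit characters -/

theorem isCharacter_of_mod_six {lam : ℕ} (h : lam % 6 = 0 ∨ lam % 6 = 2) : IsCharacter lam := by
  apply isCharacter_of_nearModular (A := {0, lam / 2 + 1}) (N := 3) (M := lam / 2 + 1) (m := 1)
  · norm_num
  · simp
  · simp
  · simp
  · rw [Finset.card_pair (by omega)]
    rfl
  · simp only [Finset.mem_insert, Finset.mem_singleton]
    rintro x (rfl | rfl) y (rfl | rfl) z (rfl | rfl) h <;> omega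
  · intro r
    simp only [Finset.mem_insert, Finset.mem_singleton, exists_eq_or_imp, exists_eq_left]
    omega
  · omega

set_option maxHeartbeats 1000000 in
theorem isCharacter_add_twenty_mul {u : ℕ} (hu : u = 1 ∨ u = 3 ∨ u = 7 ∨ u = 9) (t : ℕ) {lam : ℕ}
    (hlam : lam + 9 = 16 * u + 20 * t) : IsCharacter lam := by
  apply isCharacter_of_nearModular (A := {0, u, 7 * u, 8 * u + 10 * t}) (N := 10)
    (M := 8 * u + 10 * t) (m := 2)
  · norm_num
  · simp
  · simp
  · simp only [Finset.mem_insert, Finset.mem_singleton]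
    rintro a (rfl | rfl | rfl | rfl) <;> omega
  · rw [Finset.card_insert_of_notMem, Finset.card_insert_of_notMem, Finset.card_pair]
    · rfl
    · omega
    · simp only [Finset.mem_insert, Finset.mem_singleton]
      omega
    · simp only [Finset.mem_insert, Finset.mem_singleton]
      omega
  · simp only [Finset.mem_insert, Finset.mem_singleton]
    intro x hx y hy z hz h
    rcases hu with rfl | rfl | rfl | rfl <;> rcases hx with rfl | rfl | rfl | rfl <;>
      rcases hy with rfl | rfl | rfl | rfl <;> rcases hz with rfl | rfl | rfl | rfl <;>
      first | exact ⟨rfl, rfl⟩ | (exfalso; omega)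
  · intro r
    have hr :
        r % 10 = 0 * u % 10 ∨ r % 10 = 1 * u % 10 ∨ r % 10 = 2 * u % 10 ∨ r % 10 = 3 * u % 10 ∨
        r % 10 = 4 * u % 10 ∨ r % 10 = 5 * u % 10 ∨ r % 10 = 6 * u % 10 ∨ r % 10 = 7 * u % 10 ∨
        r % 10 = 8 * u % 10 ∨ r % 10 = 9 * u % 10 := by
      rcases hu with rfl | rfl | rfl | rfl <;> omega
    rcases hr with hr | hr | hr | hr | hr | hr | hr | hr | hr | hr
    · exact ⟨0, by simp, 0, by simp, by omega, by omega⟩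
    · exact ⟨u, by simp, u, by simp, by omega, by omega⟩
    · exact ⟨u, by simp, 0, by simp, by omega, by omega⟩
    · exact ⟨7 * u, by simp, u, by simp, by omega, by omega⟩
    · exact ⟨7 * u, by simp, 0, by simp, by omega, by omega⟩
    · exact ⟨8 * u + 10 * t, by simp, u, by simp, by omega, by omega⟩
    · exact ⟨8 * u + 10 * t, by simp, 0, by simp, by omega, by omega⟩
    · exact ⟨7 * u, by simp, 7 * u, by simp, by omega, by omega⟩
    · exact ⟨8 * u + 10 * t, by simp, 8 * u + 10 * t, by simp, by omega, by omega⟩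
    · exact ⟨8 * u + 10 * t, by simp, 7 * u, by simp, by omega, by omega⟩
  · omega

/-! ### Density -/

/-- The residue classes modulo `60` all of whose large elements are shown to be characters. -/
def CharacterClass (x : ℕ) : Prop :=
  (x % 6 = 0 ∨ x % 6 = 2) ∨ (x % 20 = 3 ∨ x % 20 = 7 ∨ x % 20 = 15 ∨ x % 20 = 19)

instance : DecidablePred CharacterClass := fun x => by
  unfold CharacterClass
  infer_instance

theorem isCharacter_of_characterClass {x : ℕ} (hx : CharacterClass x) (h : 135 ≤ x) :
    IsCharacter x := by
  rcases hx with hx | hx | hx | hx | hx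
  · exact isCharacter_of_mod_six hx
  · exact isCharacter_add_twenty_mul (u := 7) (by simp) ((x - 103) / 20) (by omega)
  · exact isCharacter_add_twenty_mul (u := 1) (by simp) ((x - 7) / 20) (by omega)
  · exact isCharacter_add_twenty_mul (u := 9) (by simp) ((x - 135) / 20) (by omega)
  · exact isCharacter_add_twenty_mul (u := 3) (by simp) ((x - 39) / 20) (by omega)

theorem count_characterClass_sixty_mul (n : ℕ) : Nat.count CharacterClass (60 * n) = 32 * n := by
  induction n with
  | zero => simp
  | succ n ih =>
    rw [mul_add, mul_one, Nat.count_add, ih]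
    have h : Nat.count (fun k => CharacterClass (60 * n + k)) 60 = Nat.count CharacterClass 60 := by
      rw [Nat.count_eq_card_filter_range, Nat.count_eq_card_filter_range]
      congr 1
      apply Finset.filter_congr
      intro x _
      unfold CharacterClass
      omega
    rw [h, show Nat.count CharacterClass 60 = 32 by decide]
    ring

theorem le_ncard_isCharacter (n : ℕ) :
    32 * (n / 60) ≤ ({lam : ℕ | IsCharacter lam} ∩ Set.Iio n).ncard + 135 := by
  have hfin : ({lam : ℕ | IsCharacter lam} ∩ Set.Iio n).Finite :=
    (Set.finite_Iio n).inter_of_right _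
  calc 32 * (n / 60) = Nat.count CharacterClass (60 * (n / 60)) :=
        (count_characterClass_sixty_mul _).symm
    _ ≤ Nat.count CharacterClass n := Nat.count_monotone _ (Nat.mul_div_le n 60)
    _ = (({x ∈ Finset.range n | CharacterClass x} : Finset ℕ) : Set ℕ).ncard := by
        rw [Nat.count_eq_card_filter_range, Set.ncard_coe_finset]
    _ ≤ (({lam : ℕ | IsCharacter lam} ∩ Set.Iio n) ∪ (Finset.range 135 : Set ℕ)).ncard := by
        apply Set.ncard_le_ncard _ (hfin.union (Finset.finite_toSet _))
        intro x hx
        simp only [Finset.coe_filter, Finset.mem_range, Set.mem_ofPred_eq] at hx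
        by_cases h : x < 135
        · exact Or.inr (by simpa using h)
        · exact Or.inl ⟨isCharacter_of_characterClass hx.2 (by omega), hx.1⟩
    _ ≤ _ := by
        refine (Set.ncard_union_le _ _).trans ?_
        rw [Set.ncard_coe_finset, Finset.card_range]

/-- The set of characters of independent Stanley sequences has lower
asymptotic density at least `121/243`; in particular it is positive. -/
theorem characters_positive_lower_density :
    (121 : ℝ) / 243 ≤
      Filter.liminf
        (fun n : ℕ => (({lam : ℕ | IsCharacter lam} ∩ Set.Iio n).ncard : ℝ) / n)
        Filter.atTop ∧
    0 <
      Filter.liminf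
        (fun n : ℕ => (({lam : ℕ | IsCharacter lam} ∩ Set.Iio n).ncard : ℝ) / n)
        Filter.atTop := by
  have key : (121 : ℝ) / 243 ≤
      Filter.liminf
        (fun n : ℕ => (({lam : ℕ | IsCharacter lam} ∩ Set.Iio n).ncard : ℝ) / n)
        Filter.atTop := by
    have hbdd : Filter.IsBoundedUnder (· ≤ ·) Filter.atTop
        (fun n : ℕ => (({lam : ℕ | IsCharacter lam} ∩ Set.Iio n).ncard : ℝ) / n) := by
      refine Filter.isBoundedUnder_of ⟨1, fun n => div_le_one_of_le₀ ?_ n.cast_nonneg⟩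
      have h := Set.ncard_le_ncard (Set.inter_subset_right (s := {lam : ℕ | IsCharacter lam}))
        (Set.finite_Iio n)
      rw [← Finset.coe_Iio, Set.ncard_coe_finset, Nat.card_Iio] at h
      rw [← Finset.coe_Iio]
      exact_mod_cast h
    refine Filter.le_liminf_of_le hbdd.isCoboundedUnder_ge ?_
    filter_upwards [Filter.eventually_ge_atTop 10000] with n hn
    have h1 := le_ncard_isCharacter n
    have h2 : 121 * n ≤ 243 * ({lam : ℕ | IsCharacter lam} ∩ Set.Iio n).ncard := by omega
    have h3 : (121 : ℝ) * n ≤ 243 * ({lam : ℕ | IsCharacter lam} ∩ Set.Iio n).ncard := by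
      exact_mod_cast h2
    have hpos : (0 : ℝ) < n := by
      exact_mod_cast (show 0 < n by omega)
    rw [div_le_div_iff₀ (by norm_num) hpos]
    linarith
  exact ⟨key, lt_of_lt_of_le (by norm_num) key⟩
end
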